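/- arXiv:2101.11584 — 2 statements merged into one kernel-verified Lean document; each statement's English description precedes it below -/
import Mathlib

section
/- Let A be a unital C*-algebra equipped with a Lipschitz filtration {A_L}_{L≥0}. If p, q ∈ P^L_n(A) are homotopic in P^L(A), then there exist integers k, l ≥ 0 and a norm-continuous map h : [0,1] → P^{3L}_{n+k+l}(A) with h(0) = p ⊕ I_k ⊕ 0_l, h(1) = q ⊕ I_k ⊕ 0_l, and ‖h(t) − h(s)‖ ≤ 19|t − s| for all t, s ∈ [0,1]. -/
open scoped NNReal

/-- Membership in the matrix level `M_n(A)_L` determined by a filtration `lev` of `A`: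
`x ∈ M_n(A)_L` iff `ξᵀ x η ∈ A_L` for all vectors `ξ, η ∈ ℂⁿ` of ℓ²-norm at most `1`. -/
def MatMem {A : Type*} [CStarAlgebra A] (lev : ℝ≥0 → Set A) {n : ℕ}
    (x : Matrix (Fin n) (Fin n) A) (L : ℝ≥0) : Prop :=
  ∀ ξ η : Fin n → ℂ, (∑ i, ‖ξ i‖ ^ 2) ≤ 1 → (∑ j, ‖η j‖ ^ 2) ≤ 1 →
    (∑ i, ∑ j, (ξ i * η j) • x i j) ∈ lev L

/-- A Lipschitz filtration `{A_L}_{L ≥ 0}` on a unital C*-algebra `A`, in the sense of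
conditions (L1)–(L6).  The C*-algebras of matrices `M_n(A)` are represented by C*-algebras
`B n` together with ⋆-algebra isomorphisms `φ n : B n ≃⋆ₐ[ℂ] Matrix (Fin n) (Fin n) A`
(recall that the C*-norm on `M_n(A)` is unique), and the matrix levels `M_n(A)_L` are the sets
`{b : B n | MatMem level (φ n b) L}`. -/
structure LipschitzFiltration (A : Type*) [CStarAlgebra A] (B : ℕ → Type*)
    [∀ n, CStarAlgebra (B n)] (φ : ∀ n, B n ≃⋆ₐ[ℂ] Matrix (Fin n) (Fin n) A) where
  level : ℝ≥0 → Set A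
  mono : ∀ ⦃L L' : ℝ≥0⦄, L ≤ L' → level L ⊆ level L'
  dense_union : Dense (⋃ L : ℝ≥0, level L)
  -- (L1)
  closed : ∀ L, IsClosed (level L)
  star_mem : ∀ (L : ℝ≥0) (a : A), a ∈ level L → star a ∈ level L
  scalar_mem : ∀ (L : ℝ≥0) (c : ℂ), c • (1 : A) ∈ level L
  -- (L2)
  smul_mem : ∀ (L : ℝ≥0) (c : ℂ) (a : A), a ∈ level L → c • a ∈ level (‖c‖₊ * L)
  -- (L3)
  add_mem : ∀ (L₁ L₂ : ℝ≥0) (a₁ a₂ : A), a₁ ∈ level L₁ → a₂ ∈ level L₂ →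
    a₁ + a₂ ∈ level (L₁ + L₂)
  -- (L4)
  mul_mem : ∀ (L₁ L₂ : ℝ≥0) (a₁ a₂ : A), a₁ ∈ level L₁ → a₂ ∈ level L₂ →
    a₁ * a₂ ∈ level (‖a₁‖₊ * L₂ + ‖a₂‖₊ * L₁)
  -- (L5): the matrix levels satisfy (L1)–(L4) in `M_n(A)` and contain all scalar matrices
  mat_closed : ∀ (n : ℕ) (L : ℝ≥0), IsClosed {b : B n | MatMem level (φ n b) L}
  mat_star : ∀ (n : ℕ) (L : ℝ≥0) (b : B n),
    MatMem level (φ n b) L → MatMem level (φ n (star b)) L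
  mat_scalar : ∀ (n : ℕ) (L : ℝ≥0) (c : Matrix (Fin n) (Fin n) ℂ),
    MatMem level (c.map (fun z : ℂ => z • (1 : A))) L
  mat_smul : ∀ (n : ℕ) (L : ℝ≥0) (c : ℂ) (b : B n),
    MatMem level (φ n b) L → MatMem level (φ n (c • b)) (‖c‖₊ * L)
  mat_add : ∀ (n : ℕ) (L₁ L₂ : ℝ≥0) (b₁ b₂ : B n),
    MatMem level (φ n b₁) L₁ → MatMem level (φ n b₂) L₂ →
      MatMem level (φ n (b₁ + b₂)) (L₁ + L₂)
  mat_mul : ∀ (n : ℕ) (L₁ L₂ : ℝ≥0) (b₁ b₂ : B n),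
    MatMem level (φ n b₁) L₁ → MatMem level (φ n b₂) L₂ →
      MatMem level (φ n (b₁ * b₂)) (‖b₁‖₊ * L₂ + ‖b₂‖₊ * L₁)
  -- (L6)
  mat_inv : ∀ (n : ℕ) (L : ℝ≥0) (b : B n) (c : ℂ)
    (h : IsUnit (b - algebraMap ℂ (B n) c)),
    MatMem level (φ n b) L →
      MatMem level (φ n ((↑h.unit⁻¹ : B n))) (‖(↑h.unit⁻¹ : B n)‖₊ ^ 2 * L)

variable {A : Type*} [CStarAlgebra A] {B : ℕ → Type*} [∀ n, CStarAlgebra (B n)]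

/-- `p ∈ P^L_n(A)`: `p` is a projection in `M_n(A)_L`. -/
def PMem (φ : ∀ n, B n ≃⋆ₐ[ℂ] Matrix (Fin n) (Fin n) A)
    (𝓕 : LipschitzFiltration A B φ) {n : ℕ} (L : ℝ≥0) (p : B n) : Prop :=
  MatMem 𝓕.level (φ n p) L ∧ IsSelfAdjoint p ∧ IsIdempotentElem p

/-- `u ∈ U^L_n(A)`: `u` is a unitary in `M_n(A)_L`. -/
def UMem (φ : ∀ n, B n ≃⋆ₐ[ℂ] Matrix (Fin n) (Fin n) A)
    (𝓕 : LipschitzFiltration A B φ) {n : ℕ} (L : ℝ≥0) (u : B n) : Prop :=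
  MatMem 𝓕.level (φ n u) L ∧ u ∈ unitary (B n)

/-- Block-diagonal direct sum `x ⊕ y ∈ M_{n+m}(A)`. -/
def oplus (φ : ∀ n, B n ≃⋆ₐ[ℂ] Matrix (Fin n) (Fin n) A)
    {n m : ℕ} (x : B n) (y : B m) : B (n + m) :=
  (φ (n + m)).symm
    (Matrix.reindex finSumFinEquiv finSumFinEquiv (Matrix.fromBlocks (φ n x) 0 0 (φ m y)))

section NewtonSign

open Filter Topology Set

variable {X : Type*} [CStarAlgebra X]

theorem isSelfAdjoint_ringInverse {y : X} (hy : IsSelfAdjoint y) :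
    IsSelfAdjoint (Ring.inverse y) := by
  rw [IsSelfAdjoint, ← Ring.inverse_star, hy.star_eq]

theorem IsSelfAdjoint.norm_sq_eq {y : X} (hy : IsSelfAdjoint y) : ‖y‖ ^ 2 = ‖y * y‖ := by
  rw [sq, ← CStarRing.norm_star_mul_self, hy.star_eq]

theorem isUnit_of_isUnit_mul_self {y : X} (h : IsUnit (y * y)) : IsUnit y := by
  rw [← sq] at h
  exact (isUnit_pow_iff two_ne_zero).1 h

theorem norm_ringInverse_sq {y : X} (hy : IsSelfAdjoint y) :
    ‖Ring.inverse y‖ ^ 2 = ‖Ring.inverse (y * y)‖ := by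
  rw [(isSelfAdjoint_ringInverse hy).norm_sq_eq, Ring.mul_inverse_rev' (Commute.refl y)]

theorem isUnit_of_mul_self_eq_one_add {z b : X} (hb : IsSelfAdjoint b)
    (hz : IsSelfAdjoint z) (h : z * z = 1 + b * b) :
    IsUnit z ∧ ‖Ring.inverse z‖ ≤ 1 := by
  let := CStarAlgebra.spectralOrder X
  let := CStarAlgebra.spectralOrderedRing X
  have hone : (1 : X) ≤ z * z := by
    rw [h]
    nth_rewrite 1 [← hb.star_eq]
    exact le_add_of_nonneg_right (star_mul_self_nonneg b)
  have hu : IsUnit (z * z) := CStarAlgebra.isUnit_of_le 1 hone (by cfc_tac)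
  refine ⟨isUnit_of_isUnit_mul_self hu, ?_⟩
  have hinv : Ring.inverse (z * z) ≤ 1 := by
    obtain ⟨u, hu'⟩ := hu
    rw [← hu'] at hone ⊢
    rw [Ring.inverse_unit]
    exact CStarAlgebra.inv_le_one hone
  have hnn : 0 ≤ Ring.inverse (z * z) := by
    rw [Ring.mul_inverse_rev' (Commute.refl z)]
    nth_rewrite 1 [← (isSelfAdjoint_ringInverse hz).star_eq]
    exact star_mul_self_nonneg _
  have := (CStarAlgebra.norm_le_one_iff_of_nonneg _ hnn).2 hinv
  rw [← norm_ringInverse_sq hz] at this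
  nlinarith [norm_nonneg (Ring.inverse z)]

theorem isUnit_of_norm_mul_self_sub_one_le {y : X} (hy : IsSelfAdjoint y)
    (h : ‖y * y - 1‖ ≤ 1 / 4) : IsUnit y ∧ ‖Ring.inverse y‖ ^ 2 ≤ 4 / 3 := by
  have hu : IsUnit (y * y) := by
    have := isUnit_one_sub_of_norm_lt_one (x := 1 - y * y)
      (by rw [norm_sub_rev]; linarith)
    simpa using this
  refine ⟨isUnit_of_isUnit_mul_self hu, ?_⟩
  rw [norm_ringInverse_sq hy]
  set w := Ring.inverse (y * y)
  rcases subsingleton_or_nontrivial X with hX | hX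
  · rw [Subsingleton.elim w 0, norm_zero]
    norm_num
  have hw : w = 1 - w * (y * y - 1) := by
    rw [mul_sub, Ring.inverse_mul_cancel _ hu]
    simp
  have h1 : ‖w‖ ≤ 1 + ‖w‖ * (1 / 4) := by
    calc ‖w‖ = ‖1 - w * (y * y - 1)‖ := by rw [← hw]
      _ ≤ ‖(1 : X)‖ + ‖w * (y * y - 1)‖ := norm_sub_le _ _
      _ ≤ 1 + ‖w‖ * (1 / 4) := by
        rw [norm_one]
        gcongr
        exact (norm_mul_le _ _).trans (by gcongr)
  linarith

/-- One step of Newton's iteration for the sign function. -/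
noncomputable def newtonStep (y : X) : X := (2⁻¹ : ℂ) • (y + Ring.inverse y)

theorem isSelfAdjoint_two_inv : IsSelfAdjoint (2⁻¹ : ℂ) := by
  simp [isSelfAdjoint_iff]

theorem isSelfAdjoint_newtonStep {y : X} (hy : IsSelfAdjoint y) :
    IsSelfAdjoint (newtonStep y) :=
  isSelfAdjoint_two_inv.smul (hy.add (isSelfAdjoint_ringInverse hy))

theorem newtonStep_mul_self {y : X} (hu : IsUnit y) :
    newtonStep y * newtonStep y =
      1 + ((2⁻¹ : ℂ) • (y - Ring.inverse y)) * ((2⁻¹ : ℂ) • (y - Ring.inverse y)) := by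
  simp only [newtonStep, smul_mul_smul_comm, mul_add, add_mul, mul_sub, sub_mul,
    Ring.mul_inverse_cancel _ hu, Ring.inverse_mul_cancel _ hu]
  module

theorem isUnit_newtonStep {y : X} (hy : IsSelfAdjoint y) (hu : IsUnit y) :
    IsUnit (newtonStep y) ∧ ‖Ring.inverse (newtonStep y)‖ ≤ 1 :=
  isUnit_of_mul_self_eq_one_add
    (isSelfAdjoint_two_inv.smul (hy.sub (isSelfAdjoint_ringInverse hy)))
    (isSelfAdjoint_newtonStep hy) (newtonStep_mul_self hu)

theorem norm_sub_ringInverse_le {y : X} (hu : IsUnit y) :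
    ‖y - Ring.inverse y‖ ≤ ‖Ring.inverse y‖ * ‖y * y - 1‖ := by
  have : y - Ring.inverse y = Ring.inverse y * (y * y - 1) := by
    rw [mul_sub, ← mul_assoc, Ring.inverse_mul_cancel _ hu, one_mul, mul_one]
  calc ‖y - Ring.inverse y‖ = ‖Ring.inverse y * (y * y - 1)‖ := by rw [← this]
    _ ≤ _ := norm_mul_le _ _

theorem norm_newtonStep_sub_le {y : X} (hu : IsUnit y) :
    ‖y - newtonStep y‖ ≤ ‖Ring.inverse y‖ * ‖y * y - 1‖ / 2 := by
  have : y - newtonStep y = (2⁻¹ : ℂ) • (y - Ring.inverse y) := by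
    rw [newtonStep]
    module
  rw [this, norm_smul]
  have := norm_sub_ringInverse_le hu
  norm_num
  linarith

theorem norm_newtonStep_mul_self_sub_one_le {y : X} (hu : IsUnit y) :
    ‖newtonStep y * newtonStep y - 1‖ ≤ (‖Ring.inverse y‖ * ‖y * y - 1‖) ^ 2 / 4 := by
  rw [newtonStep_mul_self hu, add_sub_cancel_left, smul_mul_smul_comm, norm_smul]
  have h1 := norm_sub_ringInverse_le hu
  have h2 := norm_mul_le (y - Ring.inverse y) (y - Ring.inverse y)
  have h3 := mul_self_le_mul_self (norm_nonneg _) h1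
  norm_num
  linarith

theorem norm_newtonStep_sub_newtonStep_le {y z : X} (hy : IsUnit y) (hz : IsUnit z) :
    ‖newtonStep y - newtonStep z‖ ≤
      (1 + ‖Ring.inverse y‖ * ‖Ring.inverse z‖) / 2 * ‖y - z‖ := by
  have h : Ring.inverse y - Ring.inverse z = Ring.inverse y * (z - y) * Ring.inverse z := by
    rw [mul_sub, sub_mul, Ring.inverse_mul_cancel _ hy, mul_assoc, Ring.mul_inverse_cancel _ hz,
      mul_one, one_mul]
  have h1 : ‖Ring.inverse y - Ring.inverse z‖ ≤
      ‖Ring.inverse y‖ * ‖y - z‖ * ‖Ring.inverse z‖ := by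
    rw [h, norm_sub_rev y z]
    exact (norm_mul_le _ _).trans (by gcongr; exact norm_mul_le _ _)
  have h2 : newtonStep y - newtonStep z =
      (2⁻¹ : ℂ) • ((y - z) + (Ring.inverse y - Ring.inverse z)) := by
    rw [newtonStep, newtonStep]
    module
  rw [h2, norm_smul]
  have h3 := norm_add_le (y - z) (Ring.inverse y - Ring.inverse z)
  norm_num
  linarith

theorem newtonStep_iterate_bound {y : X} (hy : IsSelfAdjoint y) (h : ‖y * y - 1‖ ≤ 1 / 4)
    (k : ℕ) : IsSelfAdjoint (newtonStep^[k] y) ∧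
      ‖newtonStep^[k] y * newtonStep^[k] y - 1‖ ≤ 1 / 4 * (1 / 2) ^ k := by
  induction k with
  | zero => simpa using ⟨hy, by simpa using h⟩
  | succ k ih =>
    rw [Function.iterate_succ_apply']
    set z := newtonStep^[k] y
    obtain ⟨hz, hk⟩ := ih
    have hk1 : (1 / 2 : ℝ) ^ k ≤ 1 := pow_le_one₀ (by norm_num) (by norm_num)
    obtain ⟨hu, hinv⟩ := isUnit_of_norm_mul_self_sub_one_le hz (by linarith)
    refine ⟨isSelfAdjoint_newtonStep hz, (norm_newtonStep_mul_self_sub_one_le hu).trans ?_⟩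
    have h0 := norm_nonneg (z * z - 1)
    rw [mul_pow, pow_succ (1 / 2 : ℝ)]
    have h2 : ‖z * z - 1‖ ^ 2 ≤ 1 / 4 * ‖z * z - 1‖ := by nlinarith
    have h3 : ‖Ring.inverse z‖ ^ 2 * ‖z * z - 1‖ ^ 2 ≤ 4 / 3 * (1 / 4 * ‖z * z - 1‖) := by
      gcongr
    linarith

theorem newtonStep_iterate_isUnit {y : X} (hy : IsSelfAdjoint y) (h : ‖y * y - 1‖ ≤ 1 / 4)
    (k : ℕ) : IsUnit (newtonStep^[k] y) ∧ ‖Ring.inverse (newtonStep^[k] y)‖ ^ 2 ≤ 4 / 3 := by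
  have hk := newtonStep_iterate_bound hy h k
  have hk1 : (1 / 2 : ℝ) ^ k ≤ 1 := pow_le_one₀ (by norm_num) (by norm_num)
  exact isUnit_of_norm_mul_self_sub_one_le hk.1 (by linarith [hk.2])

theorem norm_ringInverse_newtonStep_iterate_succ_le {y : X} (hy : IsSelfAdjoint y)
    (h : ‖y * y - 1‖ ≤ 1 / 4) (k : ℕ) : ‖Ring.inverse (newtonStep^[k + 1] y)‖ ≤ 1 := by
  rw [Function.iterate_succ_apply']
  exact (isUnit_newtonStep (newtonStep_iterate_bound hy h k).1
    (newtonStep_iterate_isUnit hy h k).1).2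

theorem exists_tendsto_newtonStep_iterate {y : X} (hy : IsSelfAdjoint y)
    (h : ‖y * y - 1‖ ≤ 1 / 4) :
    ∃ u : X, Tendsto (fun k => newtonStep^[k] y) atTop (𝓝 u) ∧ IsSelfAdjoint u ∧ u * u = 1 := by
  have hc : CauchySeq (fun k => newtonStep^[k] y) := by
    refine cauchySeq_of_le_geometric (1 / 2) 1 (by norm_num) fun k => ?_
    rw [dist_eq_norm, Function.iterate_succ_apply']
    have hk := (newtonStep_iterate_bound hy h k).2
    obtain ⟨hu, hinv⟩ := newtonStep_iterate_isUnit hy h k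
    refine (norm_newtonStep_sub_le hu).trans ?_
    have h2 : ‖Ring.inverse (newtonStep^[k] y)‖ ≤ 2 := by nlinarith
    have h3 := mul_le_mul h2 hk (norm_nonneg _) (by norm_num)
    have : (0 : ℝ) ≤ (1 / 2) ^ k := by positivity
    linarith
  obtain ⟨u, hu⟩ := cauchySeq_tendsto_of_complete hc
  refine ⟨u, hu, ?_, ?_⟩
  · refine tendsto_nhds_unique (hu.star.congr fun k => ?_) hu
    exact (newtonStep_iterate_bound hy h k).1.star_eq
  · have h1 : Tendsto (fun k => ‖newtonStep^[k] y * newtonStep^[k] y - 1‖) atTop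
        (𝓝 ‖u * u - 1‖) := ((hu.mul hu).sub_const 1).norm
    have h2 : Tendsto (fun k : ℕ => (1 / 4 * (1 / 2) ^ k : ℝ)) atTop (𝓝 (1 / 4 * 0)) :=
      (tendsto_pow_atTop_nhds_zero_of_lt_one (by norm_num) (by norm_num)).const_mul _
    have h3 := le_of_tendsto_of_tendsto' h1 h2 fun k => (newtonStep_iterate_bound hy h k).2
    rw [mul_zero] at h3
    exact sub_eq_zero.1 (norm_le_zero_iff.1 h3)

theorem norm_newtonStep_iterate_sub_le {y z : X} (hy : IsSelfAdjoint y)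
    (hy' : ‖y * y - 1‖ ≤ 1 / 4) (hz : IsSelfAdjoint z) (hz' : ‖z * z - 1‖ ≤ 1 / 4) (k : ℕ) :
    ‖newtonStep^[k + 1] y - newtonStep^[k + 1] z‖ ≤ 7 / 6 * ‖y - z‖ := by
  induction k with
  | zero =>
    obtain ⟨hu, hi⟩ := isUnit_of_norm_mul_self_sub_one_le hy hy'
    obtain ⟨hv, hj⟩ := isUnit_of_norm_mul_self_sub_one_le hz hz'
    refine (norm_newtonStep_sub_newtonStep_le hu hv).trans ?_
    refine mul_le_mul_of_nonneg_right ?_ (norm_nonneg _)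
    nlinarith [sq_nonneg (‖Ring.inverse y‖ - ‖Ring.inverse z‖)]
  | succ k ih =>
    rw [Function.iterate_succ_apply' _ (k + 1), Function.iterate_succ_apply' _ (k + 1)]
    refine (norm_newtonStep_sub_newtonStep_le (newtonStep_iterate_isUnit hy hy' _).1
      (newtonStep_iterate_isUnit hz hz' _).1).trans ?_
    have h1 := mul_le_one₀ (norm_ringInverse_newtonStep_iterate_succ_le hy hy' k)
      (norm_nonneg _) (norm_ringInverse_newtonStep_iterate_succ_le hz hz' k)
    nlinarith [norm_nonneg (newtonStep^[k + 1] y - newtonStep^[k + 1] z)]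

theorem newtonStep_of_mul_self_eq_one {y : X} (h : y * y = 1) : newtonStep y = y := by
  have : Ring.inverse y = y := Ring.inverse_unit ⟨y, y, h, h⟩
  rw [newtonStep, this]
  module

end NewtonSign

section LipschitzPaths

open Filter Topology Set

variable {X : Type*} [CStarAlgebra X]

/-- `x` and `y` are joined by a `C`-Lipschitz path in `T`. -/
def LipschitzJoined (T : Set X) (C : ℝ) (x y : X) : Prop :=
  ∃ h : ℝ → X, h 0 = x ∧ h 1 = y ∧ (∀ t ∈ Icc (0 : ℝ) 1, h t ∈ T) ∧
    ∀ t ∈ Icc (0 : ℝ) 1, ∀ s ∈ Icc (0 : ℝ) 1, ‖h t - h s‖ ≤ C * |t - s|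

theorem LipschitzJoined.symm {T : Set X} {C : ℝ} {x y : X} (h : LipschitzJoined T C x y) :
    LipschitzJoined T C y x := by
  obtain ⟨f, h0, h1, hT, hf⟩ := h
  have hmem : ∀ t ∈ Icc (0 : ℝ) 1, 1 - t ∈ Icc (0 : ℝ) 1 := fun t ht =>
    ⟨by linarith [ht.2], by linarith [ht.1]⟩
  refine ⟨fun t => f (1 - t), by simpa using h1, by simpa using h0,
    fun t ht => hT _ (hmem t ht), fun t ht s hs => ?_⟩
  convert! hf _ (hmem t ht) _ (hmem s hs) using 2
  rw [← abs_neg]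
  congr 1
  ring

theorem LipschitzJoined.trans {T : Set X} {C : ℝ} {x y z : X}
    (h : LipschitzJoined T C x y) (h' : LipschitzJoined T C y z) :
    LipschitzJoined T (2 * C) x z := by
  obtain ⟨f, f0, f1, fT, hf⟩ := h
  obtain ⟨g, g0, g1, gT, hg⟩ := h'
  have key : ∀ t ∈ Icc (0 : ℝ) 1, ∀ s ∈ Icc (0 : ℝ) 1, s ≤ t →
      ‖(if t ≤ 1 / 2 then f (2 * t) else g (2 * t - 1)) -
        (if s ≤ 1 / 2 then f (2 * s) else g (2 * s - 1))‖ ≤ 2 * C * |t - s| := by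
    intro t ht s hs hst
    have ht0 := ht.1
    have ht1 := ht.2
    have hs0 := hs.1
    have hs1 := hs.2
    rw [abs_of_nonneg (by linarith)]
    split_ifs with h1 h2 h2
    · have := hf (2 * t) ⟨by linarith, by linarith⟩ (2 * s) ⟨by linarith, by linarith⟩
      rw [abs_of_nonneg (by linarith)] at this
      linarith
    · linarith
    · have a := hf 1 ⟨by linarith, by linarith⟩ (2 * s) ⟨by linarith, by linarith⟩
      have b := hg (2 * t - 1) ⟨by linarith, by linarith⟩ 0 ⟨by linarith, by linarith⟩
      rw [abs_of_nonneg (by linarith)] at a b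
      rw [f1, ← g0] at a
      have := norm_sub_le_norm_sub_add_norm_sub (g (2 * t - 1)) (g 0) (f (2 * s))
      linarith
    · have := hg (2 * t - 1) ⟨by linarith, by linarith⟩ (2 * s - 1) ⟨by linarith, by linarith⟩
      rw [abs_of_nonneg (by linarith)] at this
      linarith
  refine ⟨fun t => if t ≤ 1 / 2 then f (2 * t) else g (2 * t - 1), by simpa using f0, ?_, ?_, ?_⟩
  · norm_num
    exact g1
  · intro t ht
    have ht0 := ht.1
    have ht1 := ht.2
    dsimp only
    split_ifs with h1
    · exact fT _ ⟨by linarith, by linarith⟩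
    · exact gT _ ⟨by linarith, by linarith⟩
  · intro t ht s hs
    rcases le_total s t with hst | hst
    · exact key t ht s hs hst
    · rw [norm_sub_rev, abs_sub_comm]
      exact key s hs t ht hst

/-- The projections contained in `S`. -/
def projectionsIn (S : Set X) : Set X := {p | p ∈ S ∧ IsSelfAdjoint p ∧ IsIdempotentElem p}

/-- The properties of the levels of a Lipschitz filtration that do not involve products. -/
structure IsResolventScale (S : ℝ≥0 → Set X) : Prop where
  mono : Monotone S
  closed : ∀ L, IsClosed (S L)
  scalar_mem : ∀ c : ℂ, c • (1 : X) ∈ S 0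
  smul_mem : ∀ {L : ℝ≥0} (c : ℂ) {x : X}, x ∈ S L → c • x ∈ S (‖c‖₊ * L)
  add_mem : ∀ {L L' : ℝ≥0} {x y : X}, x ∈ S L → y ∈ S L' → x + y ∈ S (L + L')
  inverse_mem : ∀ {L : ℝ≥0} {y : X}, IsUnit y → y ∈ S L →
    Ring.inverse y ∈ S (‖Ring.inverse y‖₊ ^ 2 * L)

namespace IsResolventScale

variable {S : ℝ≥0 → Set X}

theorem newtonStep_mem (hS : IsResolventScale S) {L κ : ℝ≥0} {y : X} (hu : IsUnit y)
    (hκ : ‖Ring.inverse y‖ ^ 2 ≤ κ) (hy : y ∈ S L) : newtonStep y ∈ S ((1 + κ) / 2 * L) := by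
  refine hS.mono ?_ (hS.smul_mem 2⁻¹ (hS.add_mem hy (hS.inverse_mem hu hy)))
  have : ‖Ring.inverse y‖₊ ^ 2 ≤ κ := hκ
  calc ‖(2⁻¹ : ℂ)‖₊ * (L + ‖Ring.inverse y‖₊ ^ 2 * L)
      = (1 + ‖Ring.inverse y‖₊ ^ 2) / 2 * L := by
        rw [nnnorm_inv, Complex.nnnorm_ofNat]
        ring
    _ ≤ (1 + κ) / 2 * L := by gcongr

theorem newtonStep_iterate_mem (hS : IsResolventScale S) {L : ℝ≥0} {y : X}
    (hy : IsSelfAdjoint y) (h : ‖y * y - 1‖ ≤ 1 / 4) (hL : y ∈ S L) (k : ℕ) :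
    newtonStep^[k + 1] y ∈ S (7 / 6 * L) := by
  induction k with
  | zero =>
    obtain ⟨hu, hi⟩ := isUnit_of_norm_mul_self_sub_one_le hy h
    have := hS.newtonStep_mem (κ := 4 / 3) hu (by simpa using hi) hL
    convert! this using 3
    rw [← NNReal.coe_inj]
    push_cast
    norm_num
  | succ k ih =>
    rw [Function.iterate_succ_apply']
    have := hS.newtonStep_mem (κ := 1) (newtonStep_iterate_isUnit hy h _).1
      (pow_le_one₀ (norm_nonneg _) (norm_ringInverse_newtonStep_iterate_succ_le hy h k)) ih
    convert! this using 2
    rw [one_add_one_eq_two, div_self two_ne_zero, one_mul]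

theorem lipschitzJoined_of_norm_sub_le (hS : IsResolventScale S) {L : ℝ≥0} {p q : X}
    (hp : p ∈ projectionsIn (S L)) (hq : q ∈ projectionsIn (S L)) (hpq : ‖p - q‖ ≤ 1 / 2) :
    LipschitzJoined (projectionsIn (S (3 * L))) 2 p q := by
  obtain ⟨hpL, hps, hpi⟩ := hp
  obtain ⟨hqL, hqs, hqi⟩ := hq
  let y : ℝ → X := fun t =>
    ((2 * (1 - t) : ℝ) : ℂ) • p + ((2 * t : ℝ) : ℂ) • q + (-1 : ℂ) • (1 : X)
  have hys : ∀ t, IsSelfAdjoint (y t) := fun t =>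
    ((IsSelfAdjoint.smul (Complex.conj_ofReal _) hps).add
      (IsSelfAdjoint.smul (Complex.conj_ofReal _) hqs)).add
      (IsSelfAdjoint.smul (by simp [isSelfAdjoint_iff]) (.one X))
  have hysq : ∀ t, y t * y t - 1 = ((-(4 * t * (1 - t)) : ℝ) : ℂ) • ((p - q) * (p - q)) := by
    intro t
    simp only [y, mul_add, add_mul, mul_sub, sub_mul, smul_mul_smul_comm, hpi.eq, hqi.eq,
      mul_one, one_mul]
    push_cast
    module
  have hybound : ∀ t ∈ Icc (0 : ℝ) 1, ‖y t * y t - 1‖ ≤ 1 / 4 := by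
    intro t ht
    rw [hysq, norm_smul, Complex.norm_real, Real.norm_eq_abs, abs_neg,
      abs_of_nonneg (by nlinarith [ht.1, ht.2])]
    have h1 : 4 * t * (1 - t) ≤ 1 := by nlinarith [sq_nonneg (2 * t - 1)]
    have h2 : ‖(p - q) * (p - q)‖ ≤ 1 / 2 * (1 / 2) := (norm_mul_le _ _).trans (by gcongr)
    nlinarith [norm_nonneg ((p - q) * (p - q))]
  have hyL : ∀ t ∈ Icc (0 : ℝ) 1, y t ∈ S (2 * L) := by
    intro t ht
    refine hS.mono (le_of_eq ?_)
      (hS.add_mem (hS.add_mem (hS.smul_mem _ hpL) (hS.smul_mem _ hqL)) (hS.scalar_mem (-1)))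
    rw [← NNReal.coe_inj]
    simp only [NNReal.coe_add, NNReal.coe_mul, coe_nnnorm, Complex.norm_real, NNReal.coe_zero,
      NNReal.coe_ofNat]
    rw [Real.norm_eq_abs, Real.norm_eq_abs,
      abs_of_nonneg (by linarith [ht.2]), abs_of_nonneg (by linarith [ht.1])]
    ring
  have hex : ∀ t ∈ Icc (0 : ℝ) 1, ∃ u : X,
      Tendsto (fun k => newtonStep^[k] (y t)) atTop (𝓝 u) ∧ IsSelfAdjoint u ∧ u * u = 1 :=
    fun t ht => exists_tendsto_newtonStep_iterate (hys t) (hybound t ht)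
  choose! u hu hus hu1 using hex
  have hfix : ∀ t ∈ Icc (0 : ℝ) 1, y t * y t = 1 → u t = y t := by
    intro t ht h
    have := hu t ht
    simp only [Function.iterate_fixed (newtonStep_of_mul_self_eq_one h)] at this
    exact tendsto_nhds_unique this tendsto_const_nhds
  refine ⟨fun t => (2⁻¹ : ℂ) • (u t + (1 : ℂ) • 1), ?_, ?_, ?_, ?_⟩
  · dsimp only
    rw [hfix 0 (by simp) (by simpa [sub_eq_zero] using hysq 0)]
    simp only [y]
    push_cast
    module
  · dsimp only
    rw [hfix 1 (by simp) (by simpa [sub_eq_zero] using hysq 1)]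
    simp only [y]
    push_cast
    module
  · intro t ht
    refine ⟨?_, isSelfAdjoint_two_inv.smul ((hus t ht).add (by simp)), ?_⟩
    · have hmem : u t ∈ S (7 / 6 * (2 * L)) :=
        (hS.closed _).mem_of_tendsto ((tendsto_add_atTop_iff_nat 1).2 (hu t ht))
          (Eventually.of_forall fun k =>
            hS.newtonStep_iterate_mem (hys t) (hybound t ht) (hyL t ht) k)
      refine hS.mono ?_ (hS.smul_mem 2⁻¹ (hS.add_mem hmem (hS.scalar_mem 1)))
      rw [← NNReal.coe_le_coe]
      push_cast
      norm_num
      linarith [L.coe_nonneg]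
    · rw [IsIdempotentElem, smul_mul_smul_comm, one_smul]
      simp only [mul_add, add_mul, hu1 t ht, mul_one, one_mul]
      module
  · intro t ht s hs
    have h1 : ‖u t - u s‖ ≤ 7 / 6 * ‖y t - y s‖ :=
      le_of_tendsto' (((tendsto_add_atTop_iff_nat 1).2 (hu t ht)).sub
        ((tendsto_add_atTop_iff_nat 1).2 (hu s hs))).norm fun k =>
          norm_newtonStep_iterate_sub_le (hys t) (hybound t ht) (hys s) (hybound s hs) k
    have h2 : y t - y s = ((-(2 * (t - s)) : ℝ) : ℂ) • (p - q) := by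
      simp only [y]
      push_cast
      module
    rw [h2, norm_smul, Complex.norm_real, Real.norm_eq_abs, abs_neg, abs_mul, abs_two] at h1
    rw [← smul_sub, add_sub_add_right_eq_sub, norm_smul]
    have h3 := mul_le_mul_of_nonneg_left hpq (abs_nonneg (t - s))
    have h4 := abs_nonneg (t - s)
    norm_num
    linarith

/-- If `v` is a partial isometry from a subprojection of `e` onto a projection orthogonal to `e`,
rotation turns `e` into `e - v* v + v v*`. -/
theorem lipschitzJoined_rotate (hS : IsResolventScale S) {L : ℝ≥0} {e v : X}
    (he : e ∈ S L) (hes : IsSelfAdjoint e) (hei : IsIdempotentElem e)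
    (hv : v * star v * v = v) (hvv : v * v = 0) (hev : e * v = 0) (hve : v * e = v)
    (hd : v * star v - star v * v ∈ S L) (ho : v + star v ∈ S L) :
    LipschitzJoined (projectionsIn (S (3 * L))) 2 e (e + (v * star v - star v * v)) := by
  have hww : star v * star v = 0 := by rw [← star_mul, hvv, star_zero]
  have hwvw : star v * v * star v = star v := by
    simpa [mul_assoc] using congrArg star hv
  have hwe : star v * e = 0 := by simpa [hes.star_eq] using congrArg star hev
  have hew : e * star v = star v := by simpa [hes.star_eq] using congrArg star hve
  set w := star v with hw
  have hsd : IsSelfAdjoint (v * w - w * v) := by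
    simp [isSelfAdjoint_iff, hw]
  have hso : IsSelfAdjoint (v + w) := by
    simp [isSelfAdjoint_iff, hw, add_comm]
  have dd : (v * w - w * v) * (v * w - w * v) = v * w + w * v := by
    linear_combination (norm := noncomm_ring) hv * w - v * hww * v + hwvw * v - w * hvv * w
  have oo : (v + w) * (v + w) = v * w + w * v := by
    simp only [mul_add, add_mul, hvv, hww]
    abel
  have d_o : (v * w - w * v) * (v + w) = v - w := by
    linear_combination (norm := noncomm_ring) hv + v * hww - w * hvv - hwvw
  have od : (v + w) * (v * w - w * v) = w - v := by
    linear_combination (norm := noncomm_ring) hvv * w - hv + hwvw - hww * v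
  have ed : e * (v * w - w * v) = - (w * v) := by
    linear_combination (norm := noncomm_ring) hev * w - hew * v
  have de : (v * w - w * v) * e = - (w * v) := by
    linear_combination (norm := noncomm_ring) v * hwe - w * hve
  have eo : e * (v + w) = w := by rw [mul_add, hev, hew, zero_add]
  have oe : (v + w) * e = v := by rw [add_mul, hve, hwe, add_zero]
  set d := v * w - w * v with hdd
  set o := v + w with hoo
  clear_value d o
  have hjnorm : ∀ x : ℝ, ‖((Real.sin x : ℝ) : ℂ) • d + ((Real.cos x : ℝ) : ℂ) • o‖ ≤ 1 := by
    intro x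
    have hsa : IsSelfAdjoint (((Real.sin x : ℝ) : ℂ) • d + ((Real.cos x : ℝ) : ℂ) • o) :=
      (IsSelfAdjoint.smul (Complex.conj_ofReal _) hsd).add
        (IsSelfAdjoint.smul (Complex.conj_ofReal _) hso)
    have hcs : ((Real.sin x : ℝ) : ℂ) ^ 2 + ((Real.cos x : ℝ) : ℂ) ^ 2 = 1 := by
      exact_mod_cast Real.sin_sq_add_cos_sq x
    have hsq : (((Real.sin x : ℝ) : ℂ) • d + ((Real.cos x : ℝ) : ℂ) • o) *
        (((Real.sin x : ℝ) : ℂ) • d + ((Real.cos x : ℝ) : ℂ) • o) = v * w + w * v := by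
      simp only [mul_add, add_mul, smul_mul_smul_comm, dd, oo, d_o, od]
      linear_combination (norm := module) hcs • (v * w + w * v)
    have hproj : IsStarProjection (v * w + w * v) := by
      refine ⟨?_, by simp [isSelfAdjoint_iff, hw]⟩
      rw [IsIdempotentElem]
      linear_combination (norm := noncomm_ring) hv * w + v * hww * v + hwvw * v + w * hvv * w
    have := hsa.norm_sq_eq
    rw [hsq] at this
    have h1 := hproj.norm_le
    nlinarith [norm_nonneg (((Real.sin x : ℝ) : ℂ) • d + ((Real.cos x : ℝ) : ℂ) • o)]
  refine ⟨fun t => e + (((Real.sin (Real.pi / 2 * t) ^ 2 : ℝ) : ℂ) • d +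
    ((Real.sin (Real.pi / 2 * t) * Real.cos (Real.pi / 2 * t) : ℝ) : ℂ) • o), ?_, ?_, ?_, ?_⟩
  · simp
  · simp
  · intro t ht
    set s := Real.sin (Real.pi / 2 * t) with hs
    set c := Real.cos (Real.pi / 2 * t) with hc
    have hsc : s ^ 2 + c ^ 2 = 1 := Real.sin_sq_add_cos_sq _
    refine ⟨?_, hes.add ((IsSelfAdjoint.smul (Complex.conj_ofReal _) hsd).add
        (IsSelfAdjoint.smul (Complex.conj_ofReal _) hso)), ?_⟩
    · refine hS.mono ?_ (hS.add_mem he (hS.add_mem (hS.smul_mem _ hd) (hS.smul_mem _ ho)))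
      rw [← NNReal.coe_le_coe]
      simp only [NNReal.coe_add, NNReal.coe_mul, coe_nnnorm, Complex.norm_real, Real.norm_eq_abs]
      have h1 : |s ^ 2| ≤ 1 := by
        rw [abs_of_nonneg (sq_nonneg s)]
        nlinarith [sq_nonneg c]
      have h2 : |s * c| ≤ 1 := by
        rw [abs_le]
        constructor <;> nlinarith [sq_nonneg (s + c), sq_nonneg (s - c)]
      have h3 := mul_le_mul_of_nonneg_right h1 L.coe_nonneg
      have h4 := mul_le_mul_of_nonneg_right h2 L.coe_nonneg
      rw [NNReal.coe_ofNat]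
      linarith
    · have hab : (((s ^ 2 : ℝ) : ℂ)) ^ 2 + ((s * c : ℝ) : ℂ) ^ 2 = ((s ^ 2 : ℝ) : ℂ) := by
        norm_cast
        linear_combination s ^ 2 * hsc
      change IsIdempotentElem (e + (((s ^ 2 : ℝ) : ℂ) • d + ((s * c : ℝ) : ℂ) • o))
      generalize ((s ^ 2 : ℝ) : ℂ) = a at hab ⊢
      generalize ((s * c : ℝ) : ℂ) = b at hab ⊢
      rw [IsIdempotentElem]
      simp only [mul_add, add_mul, mul_smul_comm, smul_mul_assoc, dd, oo, d_o, od,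
        ed, de, eo, oe, hei.eq]
      rw [hdd, hoo]
      linear_combination (norm := module) hab • (v * w + w * v)
  · intro t ht s hs
    have hkey : ∀ x z : ℝ, (e + (((Real.sin x ^ 2 : ℝ) : ℂ) • d +
        ((Real.sin x * Real.cos x : ℝ) : ℂ) • o)) - (e + (((Real.sin z ^ 2 : ℝ) : ℂ) • d +
        ((Real.sin z * Real.cos z : ℝ) : ℂ) • o)) = ((Real.sin (x - z) : ℝ) : ℂ) •
          (((Real.sin (x + z) : ℝ) : ℂ) • d + ((Real.cos (x + z) : ℝ) : ℂ) • o) := by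
      intro x z
      have h1 : Real.sin x ^ 2 - Real.sin z ^ 2 = Real.sin (x - z) * Real.sin (x + z) := by
        rw [Real.sin_add, Real.sin_sub]
        linear_combination Real.sin z ^ 2 * Real.sin_sq_add_cos_sq x -
          Real.sin x ^ 2 * Real.sin_sq_add_cos_sq z
      have h2 : Real.sin x * Real.cos x - Real.sin z * Real.cos z =
          Real.sin (x - z) * Real.cos (x + z) := by
        rw [Real.cos_add, Real.sin_sub]
        linear_combination Real.sin z * Real.cos z * Real.sin_sq_add_cos_sq x -
          Real.sin x * Real.cos x * Real.sin_sq_add_cos_sq z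
      rw [smul_add, smul_smul, smul_smul, ← Complex.ofReal_mul, ← Complex.ofReal_mul, ← h1, ← h2]
      push_cast
      module
    rw [hkey, norm_smul, Complex.norm_real, Real.norm_eq_abs]
    have h1 : |Real.sin (Real.pi / 2 * t - Real.pi / 2 * s)| ≤ 2 * |t - s| := by
      refine Real.abs_sin_le_abs.trans ?_
      rw [← mul_sub, abs_mul, abs_of_pos (by positivity)]
      gcongr
      linarith [Real.pi_le_four]
    calc _ ≤ 2 * |t - s| * 1 := mul_le_mul h1 (hjnorm _) (norm_nonneg _) (by positivity)
      _ = _ := mul_one _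

end IsResolventScale

end LipschitzPaths

section BlockMatrices

open Matrix

theorem Matrix.star_sum_single {σ ι R : Type*} [DecidableEq σ] [Fintype ι]
    [NonUnitalNonAssocSemiring R] [StarRing R] (f g : ι → σ) (d : ι → R) :
    star (∑ i, single (f i) (g i) (d i)) =
      ∑ i, single (g i) (f i) (star (d i)) := by
  rw [star_sum]
  exact Finset.sum_congr rfl fun i _ => conjTranspose_single _ _ _

variable {σ ι κ R : Type*} [Fintype σ] [DecidableEq σ] [Fintype ι] [Fintype κ]

theorem Matrix.sum_single_mul_sum_single [NonUnitalNonAssocSemiring R] {f g h : ι → σ}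
    (hg : Function.Injective g) (d d' : ι → R) :
    (∑ i, single (f i) (g i) (d i)) * (∑ i, single (g i) (h i) (d' i)) =
      ∑ i, single (f i) (h i) (d i * d' i) := by
  rw [Finset.sum_mul]
  refine Finset.sum_congr rfl fun i _ => ?_
  rw [Finset.mul_sum, Finset.sum_eq_single i]
  · simp
  · intro k _ hk
    exact single_mul_single_of_ne _ _ _ _ (fun h => hk (hg h).symm) _
  · simp

theorem Matrix.sum_single_mul_sum_single_of_ne [NonUnitalNonAssocSemiring R]
    {f g f' g' : ι → σ} (hg : ∀ i k, g i ≠ f' k) (d d' : ι → R) :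
    (∑ i, single (f i) (g i) (d i)) * (∑ i, single (f' i) (g' i) (d' i)) = 0 := by
  rw [Finset.sum_mul]
  refine Finset.sum_eq_zero fun i _ => ?_
  rw [Finset.mul_sum]
  exact Finset.sum_eq_zero fun k _ => single_mul_single_of_ne _ _ _ _ (hg i k) _

theorem Matrix.diagonal_mul_sum_single [NonUnitalNonAssocSemiring R] (D : σ → R) (f g : ι → σ)
    (d : ι → R) : diagonal D * (∑ i, single (f i) (g i) (d i)) =
      ∑ i, single (f i) (g i) (D (f i) * d i) := by
  rw [Finset.mul_sum]
  refine Finset.sum_congr rfl fun i _ => ?_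
  ext s t
  rw [diagonal_mul, single_apply, single_apply]
  split_ifs with h
  · rw [h.1]
  · rw [mul_zero]

theorem Matrix.sum_single_mul_diagonal [NonUnitalNonAssocSemiring R] (D : σ → R) (f g : ι → σ)
    (d : ι → R) : (∑ i, single (f i) (g i) (d i)) * diagonal D =
      ∑ i, single (f i) (g i) (d i * D (g i)) := by
  rw [Finset.sum_mul]
  refine Finset.sum_congr rfl fun i _ => ?_
  ext s t
  rw [mul_diagonal, single_apply, single_apply]
  split_ifs with h
  · rw [h.2]
  · rw [zero_mul]

/-- A block matrix over `M_m(A)` as an element of `M_M(A)`. -/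
noncomputable def blockHom (φ : ∀ n, B n ≃⋆ₐ[ℂ] Matrix (Fin n) (Fin n) A) {m M : ℕ}
    (e : σ × Fin m ≃ Fin M) : Matrix σ σ (B m) →⋆ₐ[ℂ] B M where
  __ := ((φ m).toAlgEquiv.mapMatrix (m := σ) |>.trans <| compAlgEquiv σ (Fin m) A ℂ |>.trans <|
    reindexAlgEquiv ℂ A e |>.trans (φ M).symm.toAlgEquiv).toAlgHom
  map_star' X := by
    change (φ M).symm (reindex e e (comp σ σ (Fin m) (Fin m) A ((star X).map (φ m)))) =
      star ((φ M).symm (reindex e e (comp σ σ (Fin m) (Fin m) A (X.map (φ m)))))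
    rw [← map_star]
    congr 1
    ext i k
    simp [comp_apply, star_apply, map_star]

theorem apply_blockHom (φ : ∀ n, B n ≃⋆ₐ[ℂ] Matrix (Fin n) (Fin n) A) {m M : ℕ}
    (e : σ × Fin m ≃ Fin M) (X : Matrix σ σ (B m)) (i k : Fin M) :
    φ M (blockHom φ e X) i k =
      φ m (X (e.symm i).1 (e.symm k).1) (e.symm i).2 (e.symm k).2 := by
  change φ M ((φ M).symm (reindex e e (comp σ σ (Fin m) (Fin m) A (X.map (φ m))))) i k = _
  rw [StarAlgEquiv.apply_symm_apply]
  rfl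

namespace LipschitzFiltration

variable {φ : ∀ n, B n ≃⋆ₐ[ℂ] Matrix (Fin n) (Fin n) A} (𝓕 : LipschitzFiltration A B φ)

/-- The sets `M_n(A)_L`. -/
def matLevel (n : ℕ) (L : ℝ≥0) : Set (B n) := {b | MatMem 𝓕.level (φ n b) L}

theorem smul_one_mem_matLevel (n : ℕ) (c : ℂ) (L : ℝ≥0) : c • (1 : B n) ∈ 𝓕.matLevel n L := by
  have h := 𝓕.mat_scalar n L (c • 1)
  have : φ n (c • 1) = (c • (1 : Matrix (Fin n) (Fin n) ℂ)).map (fun z : ℂ => z • (1 : A)) := by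
    rw [map_smul, map_one]
    ext i k
    by_cases h : i = k <;> simp [h]
  rwa [← this] at h

theorem isResolventScale (n : ℕ) : IsResolventScale (𝓕.matLevel n) where
  mono _ _ h _ hx ξ η hξ hη := 𝓕.mono h (hx ξ η hξ hη)
  closed := 𝓕.mat_closed n
  scalar_mem c := 𝓕.smul_one_mem_matLevel n c 0
  smul_mem {L} c x := 𝓕.mat_smul n L c x
  add_mem {L L' x y} := 𝓕.mat_add n L L' x y
  inverse_mem {L y} hu hy := by
    have h : IsUnit (y - algebraMap ℂ (B n) 0) := by simpa using hu
    have key : (↑h.unit⁻¹ : B n) = Ring.inverse y := by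
      rw [← Ring.inverse_unit]
      simp
    have := 𝓕.mat_inv n L y 0 h hy
    rwa [key] at this

theorem zero_mem_level (L : ℝ≥0) : (0 : A) ∈ 𝓕.level L := by
  simpa using 𝓕.scalar_mem L 0

theorem zero_mem_matLevel (n : ℕ) (L : ℝ≥0) : (0 : B n) ∈ 𝓕.matLevel n L := by
  simpa using 𝓕.smul_one_mem_matLevel n 0 L

theorem one_mem_matLevel (n : ℕ) (L : ℝ≥0) : (1 : B n) ∈ 𝓕.matLevel n L := by
  simpa using 𝓕.smul_one_mem_matLevel n 1 L

theorem neg_mem_matLevel {n : ℕ} {L : ℝ≥0} {x : B n} (hx : x ∈ 𝓕.matLevel n L) :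
    -x ∈ 𝓕.matLevel n L := by
  simpa using (𝓕.isResolventScale n).smul_mem (-1) hx

theorem one_sub_mem_matLevel {n : ℕ} {L : ℝ≥0} {x : B n} (hx : x ∈ 𝓕.matLevel n L) :
    1 - x ∈ 𝓕.matLevel n L := by
  simpa [sub_eq_add_neg] using
    (𝓕.isResolventScale n).add_mem (𝓕.one_mem_matLevel n 0) (𝓕.neg_mem_matLevel hx)

theorem sum_mem_level {f : κ → A} {l : κ → ℝ≥0} (h : ∀ k, f k ∈ 𝓕.level (l k)) :
    ∑ k, f k ∈ 𝓕.level (∑ k, l k) := by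
  classical
  induction (Finset.univ : Finset κ) using Finset.induction_on with
  | empty => simpa using 𝓕.zero_mem_level 0
  | insert a s ha ih =>
    rw [Finset.sum_insert ha, Finset.sum_insert ha]
    exact 𝓕.add_mem _ _ _ _ (h a) ih

theorem bilinear_mem_level {m : ℕ} {L : ℝ≥0} {x : B m} (hx : x ∈ 𝓕.matLevel m L)
    {ξ η : Fin m → ℂ} {a b : ℝ≥0} (hξ : ∑ i, ‖ξ i‖ ^ 2 ≤ (a : ℝ) ^ 2)
    (hη : ∑ i, ‖η i‖ ^ 2 ≤ (b : ℝ) ^ 2) :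
    ∑ i, ∑ k, (ξ i * η k) • φ m x i k ∈ 𝓕.level (a * b * L) := by
  have hzero : ∀ (ζ : Fin m → ℂ) (c : ℝ≥0), ∑ i, ‖ζ i‖ ^ 2 ≤ (c : ℝ) ^ 2 → c = 0 →
      ∀ i, ζ i = 0 := by
    rintro ζ c h rfl i
    have h0 : ∑ i, ‖ζ i‖ ^ 2 = 0 :=
      le_antisymm (by simpa using h) (Finset.sum_nonneg fun _ _ => by positivity)
    rw [Finset.sum_eq_zero_iff_of_nonneg fun _ _ => by positivity] at h0
    simpa using h0 i (Finset.mem_univ i)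
  by_cases ha : a = 0
  · simpa [hzero ξ a hξ ha] using 𝓕.zero_mem_level _
  by_cases hb : b = 0
  · simpa [hzero η b hη hb] using 𝓕.zero_mem_level _
  have hnorm : ∀ (ζ : Fin m → ℂ) (c : ℝ≥0), ∑ i, ‖ζ i‖ ^ 2 ≤ (c : ℝ) ^ 2 → c ≠ 0 →
      ∑ i, ‖((c : ℝ) : ℂ)⁻¹ * ζ i‖ ^ 2 ≤ 1 := by
    intro ζ c h hc
    have hc' : (0 : ℝ) < (c : ℝ) ^ 2 := by positivity
    simp only [norm_mul, mul_pow, ← Finset.mul_sum, norm_inv, Complex.norm_real, inv_pow,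
      Real.norm_eq_abs, sq_abs]
    rwa [inv_mul_le_one₀ hc']
  have h := 𝓕.smul_mem _ (((a : ℝ) : ℂ) * ((b : ℝ) : ℂ)) _
    (hx (fun i => ((a : ℝ) : ℂ)⁻¹ * ξ i) (fun i => ((b : ℝ) : ℂ)⁻¹ * η i)
      (hnorm ξ a hξ ha) (hnorm η b hη hb))
  have ha' : ((a : ℝ) : ℂ) ≠ 0 := by exact_mod_cast ha
  have hb' : ((b : ℝ) : ℂ) ≠ 0 := by exact_mod_cast hb
  convert! h using 2
  · congr 1
    rw [← NNReal.coe_inj]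
    simp
  · simp only [Finset.smul_sum, smul_smul]
    refine Finset.sum_congr rfl fun i _ => Finset.sum_congr rfl fun k _ => ?_
    congr 1
    field_simp

theorem blockHom_sum_single_mem {m M : ℕ} (e : σ × Fin m ≃ Fin M) {L : ℝ≥0} {r c : κ → σ}
    (hr : Function.Injective r) (hc : Function.Injective c) {d : κ → B m}
    (hd : ∀ k, d k ∈ 𝓕.matLevel m L) :
    blockHom φ e (∑ k, single (r k) (c k) (d k)) ∈ 𝓕.matLevel M L := by
  intro ξ η hξ hη
  have hsum : ∑ i, ∑ j, (ξ i * η j) • φ M (blockHom φ e (∑ k, single (r k) (c k) (d k))) i j =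
      ∑ k, ∑ x, ∑ y, (ξ (e (r k, x)) * η (e (c k, y))) • φ m (d k) x y := by
    simp only [map_sum, Matrix.sum_apply, Finset.smul_sum]
    rw [Finset.sum_congr rfl fun i _ => Finset.sum_comm, Finset.sum_comm]
    refine Finset.sum_congr rfl fun k _ => ?_
    have : ∀ s x t y, (ξ (e (s, x)) * η (e (t, y))) • φ m (single (r k) (c k) (d k) s t) x y =
        if r k = s then if c k = t then
          (ξ (e (r k, x)) * η (e (c k, y))) • φ m (d k) x y else 0 else 0 := by
      intro s x t y
      rw [single_apply]
      by_cases h1 : r k = s <;> by_cases h2 : c k = t <;> simp [h1, h2]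
    rw [← e.sum_comp]
    simp only [← e.sum_comp, apply_blockHom, e.symm_apply_apply, Fintype.sum_prod_type, this]
    rw [Finset.sum_comm]
    simp only [Finset.sum_ite_irrel, Finset.sum_const_zero, Finset.sum_ite_eq, Finset.mem_univ,
      if_true]
  rw [hsum]
  have hbound : ∀ (f : κ → σ), Function.Injective f → ∀ ζ : Fin M → ℂ, ∑ i, ‖ζ i‖ ^ 2 ≤ 1 →
      ∑ k, ∑ x, ‖ζ (e (f k, x))‖ ^ 2 ≤ 1 := by
    intro f hf ζ hζ
    rw [← e.sum_comp, Fintype.sum_prod_type] at hζ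
    refine le_trans ?_ hζ
    have := Finset.sum_image (s := Finset.univ) (g := f)
      (f := fun s => ∑ x, ‖ζ (e (s, x))‖ ^ 2) hf.injOn
    rw [← this]
    exact Finset.sum_le_sum_of_subset_of_nonneg (Finset.subset_univ _)
      fun _ _ _ => Finset.sum_nonneg fun _ _ => by positivity
  let a : κ → ℝ≥0 := fun k => NNReal.sqrt (∑ x, ‖ξ (e (r k, x))‖₊ ^ 2)
  let b : κ → ℝ≥0 := fun k => NNReal.sqrt (∑ x, ‖η (e (c k, x))‖₊ ^ 2)
  have ha : ∀ k, ∑ x, ‖ξ (e (r k, x))‖ ^ 2 = (a k : ℝ) ^ 2 := fun k => by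
    rw [← NNReal.coe_pow, NNReal.sq_sqrt]
    simp
  have hb : ∀ k, ∑ x, ‖η (e (c k, x))‖ ^ 2 = (b k : ℝ) ^ 2 := fun k => by
    rw [← NNReal.coe_pow, NNReal.sq_sqrt]
    simp
  refine 𝓕.mono ?_ (𝓕.sum_mem_level fun k =>
    𝓕.bilinear_mem_level (hd k) (ha k).le (hb k).le)
  rw [← Finset.sum_mul]
  refine mul_le_of_le_one_left' ?_
  have h1 := hbound r hr ξ hξ
  have h2 := hbound c hc η hη
  simp only [ha, hb] at h1 h2
  rw [← NNReal.coe_le_coe]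
  push_cast
  have h3 : ∑ k, (a k : ℝ) * b k ≤ ∑ k, ((a k : ℝ) ^ 2 + (b k : ℝ) ^ 2) / 2 :=
    Finset.sum_le_sum fun k _ => by nlinarith [sq_nonneg ((a k : ℝ) - b k)]
  rw [← Finset.sum_div, Finset.sum_add_distrib] at h3
  linarith

theorem blockHom_diagonal_mem {m M : ℕ} (e : σ × Fin m ≃ Fin M) {L : ℝ≥0} {D : σ → B m}
    (hD : ∀ s, D s ∈ 𝓕.matLevel m L) : blockHom φ e (diagonal D) ∈ 𝓕.matLevel M L := by
  rw [← sum_single_eq_diagonal]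
  exact 𝓕.blockHom_sum_single_mem e Function.injective_id Function.injective_id hD

theorem blockHom_diagonal_mem_projectionsIn {m M : ℕ} (e : σ × Fin m ≃ Fin M) {L : ℝ≥0}
    {D : σ → B m} (hD : ∀ s, D s ∈ projectionsIn (𝓕.matLevel m L)) :
    blockHom φ e (diagonal D) ∈ projectionsIn (𝓕.matLevel M L) := by
  refine ⟨𝓕.blockHom_diagonal_mem e fun s => (hD s).1, ?_, ?_⟩
  · rw [IsSelfAdjoint, ← map_star, star_eq_conjTranspose, diagonal_conjTranspose]
    congr 2
    exact funext fun s => (hD s).2.1.star_eq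
  · rw [IsIdempotentElem, ← map_mul, diagonal_mul_diagonal]
    congr 2
    exact funext fun s => (hD s).2.2.eq

theorem norm_blockHom_diagonal_sub_le {m M : ℕ} (e : σ × Fin m ≃ Fin M) {D D' : σ → B m} {r : ℝ}
    (hr : 0 ≤ r) (h : ∀ s, ‖D s - D' s‖ ≤ r) :
    ‖blockHom φ e (diagonal D) - blockHom φ e (diagonal D')‖ ≤ r := by
  let Ψ : (σ → B m) →⋆ₙₐ[ℂ] B M :=
    { toFun := fun D => blockHom φ e (diagonal D)
      map_smul' := fun c D => by
        rw [diagonal_smul, map_smul]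
        rfl
      map_zero' := by rw [diagonal_zero', map_zero]
      map_add' := fun D D' => by
        rw [← map_add, diagonal_add]
        rfl
      map_mul' := fun D D' => by
        rw [← map_mul, diagonal_mul_diagonal]
        rfl
      map_star' := fun D => by
        rw [← map_star, star_eq_conjTranspose, diagonal_conjTranspose] }
  change ‖Ψ D - Ψ D'‖ ≤ r
  rw [← map_sub]
  exact (NonUnitalStarAlgHom.norm_apply_le Ψ _).trans ((pi_norm_le_iff_of_nonneg hr).2 h)

/-- Projections `d i` placed in the diagonal blocks `g i` can be rotated simultaneously into
empty diagonal blocks `f i`. -/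
theorem lipschitzJoined_move {m M : ℕ} (e : σ × Fin m ≃ Fin M) {L : ℝ≥0} {D D' : σ → B m}
    (hD : ∀ s, D s ∈ projectionsIn (𝓕.matLevel m L)) {f g : ι → σ} (hf : Function.Injective f)
    (hg : Function.Injective g) (hfg : ∀ i k, f i ≠ g k) {d : ι → B m}
    (hd : ∀ i, d i ∈ projectionsIn (𝓕.matLevel m L)) (hDf : ∀ i, D (f i) = 0)
    (hDg : ∀ i, d i * D (g i) = d i)
    (hD' : D' = D + (∑ i, Pi.single (f i) (d i) - ∑ i, Pi.single (g i) (d i))) :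
    LipschitzJoined (projectionsIn (𝓕.matLevel M (3 * L))) 2
      (blockHom φ e (diagonal D)) (blockHom φ e (diagonal D')) := by
  set V : Matrix σ σ (B m) := ∑ i, single (f i) (g i) (d i) with hV
  have hVs : star V = ∑ i, single (g i) (f i) (d i) := by
    simp only [hV, star_sum_single, (hd _).2.1.star_eq]
  have hVV : V * star V = ∑ i, single (f i) (f i) (d i) := by
    rw [hVs, hV, sum_single_mul_sum_single hg]
    simp only [(hd _).2.2.eq]
  have hVV' : star V * V = ∑ i, single (g i) (g i) (d i) := by
    rw [hVs, hV, sum_single_mul_sum_single hf]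
    simp only [(hd _).2.2.eq]
  have hE := 𝓕.blockHom_diagonal_mem_projectionsIn e hD
  have hfg' : Function.Injective (Sum.elim f g) := hf.sumElim hg hfg
  have hgf' : Function.Injective (Sum.elim g f) := hg.sumElim hf fun i k => (hfg k i).symm
  have hdd : V * star V - star V * V =
      ∑ k, single (Sum.elim f g k) (Sum.elim f g k) (Sum.elim d (-d) k) := by
    simp [hVV, hVV', Fintype.sum_sum_type, sub_eq_add_neg, ← single_neg, Finset.sum_neg_distrib]
  have hdiag : diagonal D' = diagonal D + (V * star V - star V * V) := by
    have hs : ∀ h : ι → σ, diagonal (∑ i, Pi.single (h i) (d i)) =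
        ∑ i, single (h i) (h i) (d i) := by
      intro h
      rw [← diagonalAddMonoidHom_apply, map_sum]
      exact Finset.sum_congr rfl fun i _ => diagonal_single _ _
    rw [hVV, hVV', ← hs, ← hs, diagonal_sub, diagonal_add, hD']
    rfl
  have := (𝓕.isResolventScale M).lipschitzJoined_rotate (v := blockHom φ e V) hE.1 hE.2.1 hE.2.2
    (by
      rw [← map_star, ← map_mul, ← map_mul, hVV, hV, sum_single_mul_sum_single hf]
      simp only [(hd _).2.2.eq])
    (by rw [← map_mul, hV, sum_single_mul_sum_single_of_ne fun i k => (hfg k i).symm, map_zero])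
    (by
      rw [← map_mul, hV, diagonal_mul_sum_single]
      simp [hDf])
    (by
      rw [← map_mul, hV, sum_single_mul_diagonal]
      simp only [hDg])
    (L := L)
    (by
      rw [← map_star, ← map_mul, ← map_mul, ← map_sub, hdd]
      refine 𝓕.blockHom_sum_single_mem e hfg' hfg' ?_
      rintro (i | i)
      · exact (hd i).1
      · exact 𝓕.neg_mem_matLevel (hd i).1)
    (by
      have : V + star V = ∑ k, single (Sum.elim f g k) (Sum.elim g f k) (Sum.elim d d k) := by
        rw [hVs, hV]
        simp [Fintype.sum_sum_type]
      rw [← map_star, ← map_add, this]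
      refine 𝓕.blockHom_sum_single_mem e hfg' hgf' ?_
      rintro (i | i) <;> exact (hd i).1)
  rwa [← map_star, ← map_mul, ← map_mul, ← map_sub, ← map_add, ← hdiag] at this

end LipschitzFiltration

end BlockMatrices

section Stabilization

open Matrix

variable {φ : ∀ n, B n ≃⋆ₐ[ℂ] Matrix (Fin n) (Fin n) A}

theorem apply_oplus {n m : ℕ} (x : B n) (y : B m) (i k : Fin n ⊕ Fin m) :
    φ (n + m) (oplus φ x y) (finSumFinEquiv i) (finSumFinEquiv k) =
      fromBlocks (φ n x) 0 0 (φ m y) i k := by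
  rw [oplus, StarAlgEquiv.apply_symm_apply]
  simp

/-- The positions of the basis vectors of `ℂⁿ ⊕ (ℂⁿ⁺ʲ)ᴺ ⊕ ℂʲ ⊕ (ℂⁿ⁺ʲ)ᴺ` in `2N + 1` blocks of
size `n + j`. -/
def blockPosition (N n j : ℕ) :
    (Fin n ⊕ Fin N × Fin (n + j)) ⊕ (Fin j ⊕ Fin N × Fin (n + j)) →
      (Fin (N + 1) ⊕ Fin N) × Fin (n + j)
  | .inl (.inl i) => (.inl 0, finSumFinEquiv (.inl i))
  | .inl (.inr z) => (.inr z.1, z.2)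
  | .inr (.inl i) => (.inl 0, finSumFinEquiv (.inr i))
  | .inr (.inr z) => (.inl z.1.succ, z.2)

theorem blockPosition_bijective (N n j : ℕ) : Function.Bijective (blockPosition N n j) := by
  rw [Fintype.bijective_iff_injective_and_card]
  constructor
  · rintro ((i | ⟨a, x⟩) | (i | ⟨a, x⟩)) ((i' | ⟨a', x'⟩) | (i' | ⟨a', x'⟩)) h <;>
      simp only [blockPosition, Prod.mk.injEq, Sum.inl.injEq, Sum.inr.injEq, reduceCtorEq,
        Fin.succ_inj, Fin.succ_ne_zero, (Fin.succ_ne_zero _).symm, EmbeddingLike.apply_eq_iff_eq,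
        true_and, false_and] at h ⊢ <;> exact h
  · simp only [Fintype.card_sum, Fintype.card_prod, Fintype.card_fin]
    ring

/-- The enumeration of the basis vectors of `ℂⁿ ⊕ (ℂᵐ)ᴺ ⊕ ℂʲ ⊕ (ℂᵐ)ᴺ`. -/
def stabilizationEquiv (N n j m : ℕ) :
    (Fin n ⊕ Fin N × Fin m) ⊕ (Fin j ⊕ Fin N × Fin m) ≃ Fin (n + N * m + (j + N * m)) :=
  (Equiv.sumCongr
    ((Equiv.sumCongr (Equiv.refl _) finProdFinEquiv).trans finSumFinEquiv)
    ((Equiv.sumCongr (Equiv.refl _) finProdFinEquiv).trans finSumFinEquiv)).trans finSumFinEquiv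

/-- The arrangement of `2N + 1` blocks of size `n + j` for which the corner of the first block and
the last `N` blocks come first. -/
noncomputable def blockEquiv (N n j : ℕ) : (Fin (N + 1) ⊕ Fin N) × Fin (n + j) ≃
    Fin (n + N * (n + j) + (j + N * (n + j))) :=
  (Equiv.ofBijective _ (blockPosition_bijective N n j)).symm.trans (stabilizationEquiv N n j _)

theorem blockEquiv_symm_stabilizationEquiv (N n j : ℕ) (x) :
    (blockEquiv N n j).symm (stabilizationEquiv N n j _ x) = blockPosition N n j x := by
  simp [blockEquiv]

theorem blockHom_diagonal_single_eq_oplus {N n j : ℕ} (p : B n) :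
    blockHom φ (blockEquiv N n j)
      (diagonal (Sum.elim (Pi.single 0 (oplus φ p (0 : B j))) (1 : Fin N → B (n + j)))) =
      oplus φ (oplus φ p (1 : B (N * (n + j)))) (0 : B (j + N * (n + j))) := by
  refine EquivLike.injective (φ _) (Matrix.ext fun i k => ?_)
  obtain ⟨x, rfl⟩ := (stabilizationEquiv N n j _).surjective i
  obtain ⟨y, rfl⟩ := (stabilizationEquiv N n j _).surjective k
  rw [apply_blockHom, blockEquiv_symm_stabilizationEquiv, blockEquiv_symm_stabilizationEquiv,
    stabilizationEquiv, Equiv.trans_apply, Equiv.trans_apply, apply_oplus]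
  rcases x with (i | ⟨a, x⟩) | (i | ⟨a, x⟩) <;> rcases y with (k | ⟨b, y⟩) | (k | ⟨b, y⟩) <;>
    simp only [blockPosition, Equiv.sumCongr_apply, Sum.map_inl, Sum.map_inr, Equiv.trans_apply,
      fromBlocks_apply₁₁, fromBlocks_apply₁₂, fromBlocks_apply₂₁, fromBlocks_apply₂₂, apply_oplus,
      diagonal_apply, Sum.elim_inl, Sum.elim_inr, Pi.single_eq_same, Equiv.refl_apply,
      map_zero, map_one, one_apply, Matrix.zero_apply, if_true, reduceCtorEq, if_false,
      Sum.inl.injEq, Sum.inr.injEq, (Fin.succ_ne_zero _).symm, Fin.succ_ne_zero,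
      Pi.single_eq_of_ne, Pi.one_apply, EmbeddingLike.apply_eq_iff_eq, Prod.mk.injEq, ne_eq,
      not_false_eq_true, ite_self]
  · split_ifs <;> simp_all [one_apply]

theorem exists_uniform_subdivision {X : Type*} [PseudoMetricSpace X] {g : ℝ → X}
    (hg : ContinuousOn g (Set.Icc 0 1)) {ε : ℝ} (hε : 0 < ε) :
    ∃ (N : ℕ) (t : Fin (N + 1) → ℝ), 0 < N ∧ (∀ i, t i ∈ Set.Icc (0 : ℝ) 1) ∧ t 0 = 0 ∧
      t (Fin.last N) = 1 ∧ ∀ i : Fin N, dist (g (t i.castSucc)) (g (t i.succ)) < ε := by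
  obtain ⟨δ, hδ, h⟩ := Metric.uniformContinuousOn_iff.1
    (isCompact_Icc.uniformContinuousOn_of_continuous hg) ε hε
  obtain ⟨k, hk⟩ := exists_nat_one_div_lt hδ
  have hmem : ∀ i : Fin (k + 1 + 1), (i : ℝ) / (k + 1) ∈ Set.Icc (0 : ℝ) 1 := fun i => by
    refine ⟨by positivity, ?_⟩
    rw [div_le_one (by positivity)]
    exact_mod_cast Nat.lt_succ_iff.1 i.2
  refine ⟨k + 1, fun i => i / (k + 1), k.succ_pos, hmem, by simp, ?_, fun i => ?_⟩
  · simp only [Fin.val_last]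
    push_cast
    exact div_self (by positivity)
  · refine h _ (hmem _) _ (hmem _) ?_
    rw [dist_comm, Real.dist_eq, ← sub_div, Fin.val_succ, Fin.val_castSucc]
    push_cast
    rw [add_sub_cancel_left, abs_of_pos (by positivity)]
    exact hk

end Stabilization

/-- if `p, q ∈ P^L_n(A)` are homotopic in `P^L(A)` (i.e. `p ⊕ 0_j` and
`q ⊕ 0_j` are joined by a norm-continuous path of projections at level `L` for some `j`),
then after adding `I_k ⊕ 0_l` they are joined by a 19-Lipschitz homotopy of projections at
level `3L`. -/
theorem stmt9 (φ : ∀ n, B n ≃⋆ₐ[ℂ] Matrix (Fin n) (Fin n) A)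
    (𝓕 : LipschitzFiltration A B φ) {n : ℕ} (L : ℝ≥0) (p q : B n)
    (hp : PMem φ 𝓕 L p) (hq : PMem φ 𝓕 L q)
    (hhom : ∃ (j : ℕ) (g : ℝ → B (n + j)), ContinuousOn g (Set.Icc (0 : ℝ) 1) ∧
      g 0 = oplus φ p (0 : B j) ∧ g 1 = oplus φ q (0 : B j) ∧
      ∀ t ∈ Set.Icc (0 : ℝ) 1, PMem φ 𝓕 L (g t)) :
    ∃ (k l : ℕ) (h : ℝ → B (n + k + l)),
      h 0 = oplus φ (oplus φ p (1 : B k)) (0 : B l) ∧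
      h 1 = oplus φ (oplus φ q (1 : B k)) (0 : B l) ∧
      (∀ t ∈ Set.Icc (0 : ℝ) 1, PMem φ 𝓕 (3 * L) (h t)) ∧
      (∀ t ∈ Set.Icc (0 : ℝ) 1, ∀ s ∈ Set.Icc (0 : ℝ) 1, ‖h t - h s‖ ≤ 19 * |t - s|) := by
  obtain ⟨j, g, hg, hg0, hg1, hgL⟩ := hhom
  obtain ⟨N, t, hN, ht, ht0, ht1, hdist⟩ := exists_uniform_subdivision hg (ε := 1 / 2) (by norm_num)
  refine ⟨N * (n + j), j + N * (n + j), ?_⟩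
  let P : Fin (N + 1) → B (n + j) := fun i => g (t i)
  have hP : ∀ i, P i ∈ projectionsIn (𝓕.matLevel (n + j) L) := fun i => hgL _ (ht i)
  have h0 : (0 : B (n + j)) ∈ projectionsIn (𝓕.matLevel (n + j) L) :=
    ⟨𝓕.zero_mem_matLevel _ _, .zero _, .zero⟩
  have hsub : ∀ x ∈ projectionsIn (𝓕.matLevel (n + j) L),
      1 - x ∈ projectionsIn (𝓕.matLevel (n + j) L) := fun x hx =>
    ⟨𝓕.one_sub_mem_matLevel hx.1, (IsSelfAdjoint.one _).sub hx.2.1, hx.2.2.one_sub⟩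
  have h1 : (1 : B (n + j)) ∈ projectionsIn (𝓕.matLevel (n + j) L) := by
    simpa using hsub 0 h0
  have hsingle : ∀ a b s, (Sum.elim (Pi.single a (P b)) 1 : Fin (N + 1) ⊕ Fin N → B (n + j)) s ∈
      projectionsIn (𝓕.matLevel (n + j) L) := by
    rintro a b (i | i)
    · by_cases h : i = a
      · subst h
        simpa using hP b
      · simpa [h] using h0
    · exact h1
  have hlast : Fin.last N ≠ 0 := by simpa [Fin.ext_iff] using hN.ne'
  have s1 := 𝓕.lipschitzJoined_move (blockEquiv N n j) (hsingle 0 0)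
    (D' := Sum.elim P fun i => 1 - P i.succ) (f := fun i => Sum.inl i.succ) (g := Sum.inr)
    (d := fun i => P i.succ) (fun _ _ h => Fin.succ_injective N (Sum.inl_injective h))
    Sum.inr_injective (fun _ _ => by simp) (fun i => hP i.succ)
    (fun i => by simp) (fun i => by simp) (by
      ext (i | i)
      · cases i using Fin.cases <;>
          simp [Pi.single_apply, Finset.sum_apply, (Fin.succ_ne_zero _).symm]
      · simp [Pi.single_apply, Finset.sum_apply, sub_eq_add_neg])
  have s3 := 𝓕.lipschitzJoined_move (blockEquiv N n j) (hsingle (Fin.last N) (Fin.last N))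
    (D' := Sum.elim P fun i => 1 - P i.castSucc) (f := fun i => Sum.inl i.castSucc) (g := Sum.inr)
    (d := fun i => P i.castSucc) (fun _ _ h => Fin.castSucc_injective N (Sum.inl_injective h))
    Sum.inr_injective (fun _ _ => by simp) (fun i => hP i.castSucc)
    (fun i => by simp [(Fin.castSucc_lt_last i).ne]) (fun i => by simp) (by
      ext (i | i)
      · cases i using Fin.lastCases <;> simp [Pi.single_apply, Finset.sum_apply]
      · simp [Pi.single_apply, Finset.sum_apply, sub_eq_add_neg])
  have s4 := 𝓕.lipschitzJoined_move (blockEquiv N n j) (hsingle 0 (Fin.last N))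
    (D' := Sum.elim (Pi.single (Fin.last N) (P (Fin.last N))) 1)
    (f := fun _ : Unit => Sum.inl (Fin.last N)) (g := fun _ => Sum.inl 0)
    (d := fun _ => P (Fin.last N)) (Function.injective_of_subsingleton _)
    (Function.injective_of_subsingleton _) (fun _ _ => by simpa using hlast) (fun _ => hP _)
    (fun _ => by simp [hlast]) (fun _ => by simpa using (hP (Fin.last N)).2.2.eq) (by
      ext (i | i)
      · by_cases h0 : i = 0 <;> by_cases h1 : i = Fin.last N <;> simp_all [Pi.single_apply]
      · simp)
  have s2 := (𝓕.isResolventScale _).lipschitzJoined_of_norm_sub_le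
    (𝓕.blockHom_diagonal_mem_projectionsIn (blockEquiv N n j)
      (D := Sum.elim P fun i => 1 - P i.succ)
      (Sum.rec hP fun i => hsub _ (hP _)))
    (𝓕.blockHom_diagonal_mem_projectionsIn (blockEquiv N n j)
      (D := Sum.elim P fun i => 1 - P i.castSucc)
      (Sum.rec hP fun i => hsub _ (hP _)))
    (LipschitzFiltration.norm_blockHom_diagonal_sub_le _ (by norm_num) (by
      rintro (i | i)
      · simp
      · simpa [dist_eq_norm] using (hdist i).le))
  obtain ⟨h, hh0, hh1, hmem, hlip⟩ := (s1.trans s2).trans (s3.symm.trans s4.symm)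
  refine ⟨h, ?_, ?_, hmem, fun t ht s hs => (hlip t ht s hs).trans ?_⟩
  · rw [hh0, ← blockHom_diagonal_single_eq_oplus, ← hg0, ← ht0]
  · rw [hh1, ← blockHom_diagonal_single_eq_oplus, ← hg1, ← ht1]
  · gcongr
    norm_num
end

section
/- Let A be a unital C*-algebra equipped with a Lipschitz filtration {A_L}_{L≥0}. If u, v ∈ U^L_n(A) are homotopic in U^L(A), then there exist an integer N ≥ n and a norm-continuous map h : [0,1] → U^{4L}_N(A) with h(0) = u ⊕ I_{N−n}, h(1) = v ⊕ I_{N−n}, and ‖h(t) − h(s)‖ ≤ 11|t − s| for all t, s ∈ [0,1]. -/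
open scoped NNReal

variable {A : Type*} [CStarAlgebra A] {B : ℕ → Type*} [∀ n, CStarAlgebra (B n)]

/-- `x` and `y` are the endpoints of a `1`-Lipschitz path in `S` parametrised by `[0, ℓ]`. -/
def LipJoined {E : Type*} [NormedAddCommGroup E] (S : Set E) (ℓ : ℝ) (x y : E) : Prop :=
  ∃ h : ℝ → E, h 0 = x ∧ h ℓ = y ∧ (∀ t ∈ Set.Icc 0 ℓ, h t ∈ S) ∧
    ∀ s ∈ Set.Icc 0 ℓ, ∀ t ∈ Set.Icc 0 ℓ, s ≤ t → ‖h t - h s‖ ≤ t - s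

namespace LipJoined

variable {E : Type*} [NormedAddCommGroup E] {S : Set E} {ℓ ℓ' : ℝ} {x y z : E}

theorem refl (hx : x ∈ S) (ℓ : ℝ) : LipJoined S ℓ x x :=
  ⟨fun _ => x, rfl, rfl, fun _ _ => hx, fun s _ t _ hst => by simpa using hst⟩

theorem trans (hℓ : 0 ≤ ℓ) (hℓ' : 0 ≤ ℓ') (hxy : LipJoined S ℓ x y) (hyz : LipJoined S ℓ' y z) :
    LipJoined S (ℓ + ℓ') x z := by
  obtain ⟨f, f0, f1, fS, fL⟩ := hxy
  obtain ⟨g, g0, g1, gS, gL⟩ := hyz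
  have key : ∀ t, ℓ ≤ t → (if t ≤ ℓ then f t else g (t - ℓ)) = g (t - ℓ) := by
    intro t ht
    split_ifs with h
    · obtain rfl := le_antisymm h ht
      simp [f1, g0]
    · rfl
  refine ⟨fun t => if t ≤ ℓ then f t else g (t - ℓ), by simp [hℓ, f0], ?_, ?_, ?_⟩
  · rw [← g1, ← add_sub_cancel_left ℓ ℓ']
    exact (key _ (by linarith)).trans (by rw [add_sub_cancel_left])
  · rintro t ⟨ht0, ht1⟩
    dsimp only
    split_ifs with h
    · exact fS t ⟨ht0, h⟩
    · exact gS _ ⟨by linarith, by linarith⟩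
  · rintro s ⟨hs0, hs1⟩ t ⟨ht0, ht1⟩ hst
    dsimp only
    rcases le_total t ℓ with h | h
    · rw [if_pos h, if_pos (hst.trans h)]
      exact fL s ⟨hs0, hst.trans h⟩ t ⟨ht0, h⟩ hst
    · rw [key t h]
      rcases le_total s ℓ with h' | h'
      · rw [if_pos h']
        have h1 := fL s ⟨hs0, h'⟩ ℓ ⟨hℓ, le_rfl⟩ h'
        have h2 := gL 0 ⟨le_rfl, hℓ'⟩ (t - ℓ) ⟨by linarith, by linarith⟩ (by linarith)
        have h3 := norm_sub_le_norm_sub_add_norm_sub (g (t - ℓ)) (g 0) (f s)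
        rw [f1, ← g0] at h1
        linarith
      · rw [key s h']
        have := gL (s - ℓ) ⟨by linarith, by linarith⟩ (t - ℓ) ⟨by linarith, by linarith⟩
          (by linarith)
        linarith

/-- Rescale a `1`-Lipschitz path of length at most `K` to a `K`-Lipschitz path on `[0, 1]`. -/
theorem exists_lipschitz {K : ℝ} (hℓ : 0 ≤ ℓ) (hK : ℓ ≤ K) (hy : y ∈ S)
    (hxy : LipJoined S ℓ x y) :
    ∃ h : ℝ → E, h 0 = x ∧ h 1 = y ∧ (∀ t ∈ Set.Icc (0 : ℝ) 1, h t ∈ S) ∧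
      ∀ t ∈ Set.Icc (0 : ℝ) 1, ∀ s ∈ Set.Icc (0 : ℝ) 1, ‖h t - h s‖ ≤ K * |t - s| := by
  have hK0 : 0 ≤ K := hℓ.trans hK
  obtain ⟨f, f0, f1, fS, fL⟩ := hxy.trans hℓ (sub_nonneg.2 hK) (.refl hy (K - ℓ))
  rw [add_sub_cancel] at f1 fS fL
  have hmem : ∀ t ∈ Set.Icc (0 : ℝ) 1, K * t ∈ Set.Icc 0 K := fun t ht =>
    ⟨mul_nonneg hK0 ht.1, mul_le_of_le_one_right hK0 ht.2⟩
  refine ⟨fun t => f (K * t), by simpa using f0, by simpa using f1,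
    fun t ht => fS _ (hmem t ht), fun t ht s hs => ?_⟩
  dsimp only
  rcases le_total s t with h | h
  · rw [abs_of_nonneg (by linarith), mul_sub]
    exact fL _ (hmem s hs) _ (hmem t ht) (by gcongr)
  · rw [abs_of_nonpos (by linarith), norm_sub_rev, neg_sub, mul_sub]
    exact fL _ (hmem t ht) _ (hmem s hs) (by gcongr)

end LipJoined

section CStar

variable {E : Type*} [CStarAlgebra E]

theorem norm_one_le_one_of_cstar : ‖(1 : E)‖ ≤ 1 := by
  nontriviality E
  exact CStarRing.norm_one.le

theorem norm_le_one_of_mem_unitary {u : E} (hu : u ∈ unitary E) : ‖u‖ ≤ 1 := by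
  nontriviality E
  exact (CStarRing.norm_of_mem_unitary hu).le

/-- The element `c + i s q`; for a symmetry `q` and `c = cos θ`, `s = sin θ` this is
`exp (i θ q)`. -/
noncomputable def symmetryRot (q : E) (c s : ℝ) : E := (c : ℂ) • 1 + (s * Complex.I : ℂ) • q

theorem symmetryRot_sub (q : E) (c s c' s' : ℝ) :
    symmetryRot q c s - symmetryRot q c' s' = symmetryRot q (c - c') (s - s') := by
  simp only [symmetryRot, Complex.ofReal_sub]
  module

theorem star_symmetryRot {q : E} (hq : star q = q) (c s : ℝ) :
    star (symmetryRot q c s) = symmetryRot q c (-s) := by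
  simp [symmetryRot, hq]

theorem symmetryRot_mul {q : E} (hq2 : q * q = 1) (c s c' s' : ℝ) :
    symmetryRot q c s * symmetryRot q c' s' =
      symmetryRot q (c * c' - s * s') (c * s' + s * c') := by
  simp only [symmetryRot, mul_add, add_mul, smul_mul_assoc, mul_smul_comm, one_mul, mul_one, hq2]
  push_cast
  match_scalars
  · linear_combination (s * s' : ℂ) * Complex.I_sq
  · ring

theorem symmetryRot_one_zero (q : E) : symmetryRot q 1 0 = 1 := by
  simp [symmetryRot]

theorem symmetryRot_mem_unitary {q : E} (hq : star q = q) (hq2 : q * q = 1) (θ : ℝ) :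
    symmetryRot q (Real.cos θ) (Real.sin θ) ∈ unitary E := by
  rw [Unitary.mem_iff, star_symmetryRot hq, symmetryRot_mul hq2, symmetryRot_mul hq2,
    ← symmetryRot_one_zero q]
  have := Real.sin_sq_add_cos_sq θ
  constructor <;> congr 1 <;> nlinarith

theorem norm_symmetryRot_sq_le {q : E} (hq : star q = q) (hq2 : q * q = 1) (c s : ℝ) :
    ‖symmetryRot q c s‖ ^ 2 ≤ c ^ 2 + s ^ 2 := by
  rw [sq, ← CStarRing.norm_star_mul_self, star_symmetryRot hq, symmetryRot_mul hq2,
    show c * s + -s * c = 0 by ring, symmetryRot]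
  simp only [Complex.ofReal_zero, zero_mul, zero_smul, add_zero]
  rw [norm_smul, Complex.norm_real, Real.norm_eq_abs,
    abs_of_nonneg (by nlinarith [sq_nonneg c, sq_nonneg s])]
  have := mul_le_mul_of_nonneg_left (norm_one_le_one_of_cstar (E := E))
    (add_nonneg (sq_nonneg c) (sq_nonneg s))
  nlinarith

theorem norm_symmetryRot_cos_sin_sub_le {q : E} (hq : star q = q) (hq2 : q * q = 1)
    (θ θ' : ℝ) :
    ‖symmetryRot q (Real.cos θ) (Real.sin θ) - symmetryRot q (Real.cos θ') (Real.sin θ')‖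
      ≤ |θ - θ'| := by
  rw [symmetryRot_sub]
  refine abs_le_of_sq_le_sq' ?_ (abs_nonneg _) |>.2
  refine (norm_symmetryRot_sq_le hq hq2 _ _).trans ?_
  have h1 := Real.one_sub_sq_div_two_le_cos (x := θ - θ')
  rw [Real.cos_sub] at h1
  rw [sq_abs]
  nlinarith [Real.sin_sq_add_cos_sq θ, Real.sin_sq_add_cos_sq θ']

/-- Conjugating `a` by a symmetry `q` is implemented by a path of length `π`. -/
theorem lipJoined_conj_symmetry {S : Set E} {q a b : E} (hq : star q = q) (hq2 : q * q = 1)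
    (ha : ‖a‖ ≤ 1) (hb : ‖b‖ ≤ 1)
    (hS : ∀ θ : ℝ, symmetryRot q (Real.cos θ) (Real.sin θ) * a *
      star (symmetryRot q (Real.cos θ) (Real.sin θ)) * b ∈ S) :
    LipJoined S Real.pi (a * b) (q * a * q * b) := by
  set V : ℝ → E := fun θ => symmetryRot q (Real.cos θ) (Real.sin θ) with hV
  have hV1 : ∀ θ, ‖V θ‖ ≤ 1 := fun θ =>
    norm_le_one_of_mem_unitary (symmetryRot_mem_unitary hq hq2 θ)
  refine ⟨fun t => V (t / 2) * a * star (V (t / 2)) * b, ?_, ?_, fun t _ => hS _, ?_⟩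
  · simp [hV, symmetryRot_one_zero]
  · simp only [hV, Real.cos_pi_div_two, Real.sin_pi_div_two, star_symmetryRot hq]
    simp only [symmetryRot, Complex.ofReal_zero, zero_smul, zero_add, Complex.ofReal_neg,
      Complex.ofReal_one, one_mul, neg_mul, neg_smul, smul_mul_assoc, mul_smul_comm, mul_neg,
      smul_smul, Complex.I_mul_I, one_smul, neg_neg]
  · rintro s - t - hst
    dsimp only
    have hd : ‖V (t / 2) - V (s / 2)‖ ≤ (t - s) / 2 := by
      refine (norm_symmetryRot_cos_sin_sub_le hq hq2 _ _).trans_eq ?_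
      rw [abs_of_nonneg] <;> linarith
    have hd0 : 0 ≤ (t - s) / 2 := by linarith
    rw [show V (t / 2) * a * star (V (t / 2)) * b - V (s / 2) * a * star (V (s / 2)) * b =
      (V (t / 2) - V (s / 2)) * (a * (star (V (t / 2)) * b)) +
        V (s / 2) * (a * (star (V (t / 2) - V (s / 2)) * b)) by rw [star_sub]; noncomm_ring]
    have e1 : ‖(V (t / 2) - V (s / 2)) * (a * (star (V (t / 2)) * b))‖
        ≤ (t - s) / 2 * (1 * (1 * 1)) :=
      norm_mul_le_of_le hd (norm_mul_le_of_le ha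
        (norm_mul_le_of_le ((norm_star _).trans_le (hV1 _)) hb))
    have e2 : ‖V (s / 2) * (a * (star (V (t / 2) - V (s / 2)) * b))‖
        ≤ 1 * (1 * ((t - s) / 2 * 1)) :=
      norm_mul_le_of_le (hV1 _) (norm_mul_le_of_le ha
        (norm_mul_le_of_le ((norm_star _).trans_le hd) hb))
    linarith [norm_add_le ((V (t / 2) - V (s / 2)) * (a * (star (V (t / 2)) * b)))
      (V (s / 2) * (a * (star (V (t / 2) - V (s / 2)) * b)))]

/-- A unitary `w` close to `1` is joined to `1` by its Cayley path `f`, whose points are expressed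
through the resolvents `H s = ((1 - s) w + (1 + s))⁻¹`. -/
theorem exists_cayley_path {w : E} (hw : w ∈ unitary E) (hw1 : ‖w - 1‖ ≤ 1 / 3) :
    ∃ f H : ℝ → E, f 0 = 1 ∧ f 1 = w ∧ ∀ s ∈ Set.Icc (0 : ℝ) 1,
      f s ∈ unitary E ∧
      (((1 - s : ℝ) : ℂ) • w + ((1 + s : ℝ) : ℂ) • 1) * H s = 1 ∧
      H s * (((1 - s : ℝ) : ℂ) • w + ((1 + s : ℝ) : ℂ) • 1) = 1 ∧
      ‖H s‖ ≤ 3 / 5 ∧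
      ((1 - s : ℝ) : ℂ) • f s = ((1 + s : ℝ) : ℂ) • 1 - ((4 * s : ℝ) : ℂ) • H s ∧
      ∀ t ∈ Set.Icc (0 : ℝ) 1, ‖f t - f s‖ ≤ |t - s| := by
  obtain ⟨hw2, hw3⟩ := Unitary.mem_iff.1 hw
  set d := w - 1 with hd
  have hwd : w = 1 + d := by rw [hd]; abel
  set G : ℝ → E := fun s => ((1 - s : ℝ) : ℂ) • w + ((1 + s : ℝ) : ℂ) • 1 with hG
  have hGd : ∀ s, G s = (2 : ℂ) • 1 + ((1 - s : ℝ) : ℂ) • d := by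
    intro s
    simp only [hG, hwd]
    push_cast
    module
  have hsd : ∀ s ∈ Set.Icc (0 : ℝ) 1, ‖((1 - s : ℝ) : ℂ) • d‖ ≤ 1 / 3 := by
    intro s hs
    rw [norm_smul, Complex.norm_real, Real.norm_eq_abs, abs_of_nonneg (by linarith [hs.2])]
    nlinarith [norm_nonneg d, hs.1, hs.2]
  have hU : ∀ s ∈ Set.Icc (0 : ℝ) 1, IsUnit (G s) := by
    intro s hs
    have h1 : IsUnit (1 - -((2 : ℂ)⁻¹ • ((1 - s : ℝ) : ℂ) • d)) := by
      refine isUnit_one_sub_of_norm_lt_one ?_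
      rw [norm_neg, norm_smul]
      have := hsd s hs
      norm_num at this ⊢
      linarith
    have h2 : G s = algebraMap ℂ E 2 * (1 - -((2 : ℂ)⁻¹ • ((1 - s : ℝ) : ℂ) • d)) := by
      rw [hGd, ← Algebra.smul_def]
      module
    rw [h2]
    exact ((IsUnit.mk0 (2 : ℂ) two_ne_zero).map _).mul h1
  set H : ℝ → E := fun s => Ring.inverse (G s) with hH
  have hGH : ∀ s ∈ Set.Icc (0 : ℝ) 1, G s * H s = 1 := fun s hs =>
    Ring.mul_inverse_cancel _ (hU s hs)
  have hHG : ∀ s ∈ Set.Icc (0 : ℝ) 1, H s * G s = 1 := fun s hs =>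
    Ring.inverse_mul_cancel _ (hU s hs)
  have hHn : ∀ s ∈ Set.Icc (0 : ℝ) 1, ‖H s‖ ≤ 3 / 5 := by
    intro s hs
    have h1 : (2 : ℂ) • H s = 1 - ((1 - s : ℝ) : ℂ) • d * H s := by
      rw [← hGH s hs, hGd, add_mul, smul_mul_assoc, one_mul]
      abel
    have h2 := norm_sub_le (1 : E) (((1 - s : ℝ) : ℂ) • d * H s)
    rw [← h1, norm_smul, Complex.norm_two] at h2
    have h3 := norm_mul_le_of_le (hsd s hs) (le_refl ‖H s‖)
    have h4 := norm_one_le_one_of_cstar (E := E)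
    linarith
  set f : ℝ → E := fun s => 1 + ((2 * s : ℝ) : ℂ) • (d * H s) with hf
  have hfN : ∀ s ∈ Set.Icc (0 : ℝ) 1,
      f s = (((1 + s : ℝ) : ℂ) • w + ((1 - s : ℝ) : ℂ) • 1) * H s := by
    intro s hs
    simp only [hf]
    nth_rewrite 1 [← hGH s hs]
    rw [← smul_mul_assoc, ← add_mul]
    congr 1
    simp only [hG, hwd]
    push_cast
    module
  refine ⟨f, H, by simp [hf], ?_, fun s hs => ⟨?_, hGH s hs, hHG s hs, hHn s hs, ?_, ?_⟩⟩
  · have h1 : H 1 = (2 : ℂ)⁻¹ • 1 := by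
      have := hHG 1 ⟨zero_le_one, le_rfl⟩
      simp only [hG] at this
      norm_num at this
      rw [← this, smul_smul]
      norm_num
    simp only [hf, h1, hwd]
    simp
  · have hn : star (((1 + s : ℝ) : ℂ) • w + ((1 - s : ℝ) : ℂ) • 1) *
        (((1 + s : ℝ) : ℂ) • w + ((1 - s : ℝ) : ℂ) • 1) = star (G s) * G s := by
      simp only [hG, star_add, star_smul, star_one, mul_add, add_mul, smul_mul_assoc,
        mul_smul_comm, hw2, one_mul, mul_one, Complex.star_def, Complex.conj_ofReal]
      push_cast
      module
    have hc : star (G s) * G s = G s * star (G s) := by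
      simp only [hG, star_add, star_smul, star_one, mul_add, add_mul, smul_mul_assoc,
        mul_smul_comm, hw2, hw3, one_mul, mul_one, Complex.star_def, Complex.conj_ofReal]
      push_cast
      module
    have hsw : ((1 + s : ℝ) : ℂ) • w + ((1 - s : ℝ) : ℂ) • 1 = w * star (G s) := by
      simp only [hG, star_add, star_smul, star_one, mul_add,
        mul_smul_comm, hw3, mul_one, Complex.star_def, Complex.conj_ofReal]
      push_cast
      module
    have hGs : star (H s) * star (G s) = 1 := by rw [← star_mul, hGH s hs, star_one]
    have hGs' : star (G s) * star (H s) = 1 := by rw [← star_mul, hHG s hs, star_one]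
    rw [Unitary.mem_iff, hfN s hs]
    constructor
    · rw [star_mul, mul_assoc, ← mul_assoc _ _ (H s), hn, mul_assoc, hGH s hs, mul_one, hGs]
    · have h1 : H s * star (H s) = star (H s) * H s := by
        calc H s * star (H s) = (star (H s) * star (G s)) * (H s * star (H s)) := by
              rw [hGs, one_mul]
          _ = star (H s) * (H s * G s) * star (G s) * (H s * star (H s)) := by
              rw [hHG s hs, mul_one]
          _ = star (H s) * H s * (star (G s) * G s) * (H s * star (H s)) := by
              rw [hc]; noncomm_ring
          _ = star (H s) * H s * (star (G s) * ((G s * H s) * star (H s))) := by noncomm_ring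
          _ = star (H s) * H s := by rw [hGH s hs, one_mul, hGs', mul_one]
      rw [hsw, star_mul, star_mul, star_star]
      calc w * star (G s) * H s * (star (H s) * (G s * star w))
          = w * star (G s) * (H s * star (H s)) * (G s * star w) := by noncomm_ring
        _ = w * ((star (G s) * star (H s)) * (H s * G s)) * star w := by
            rw [h1]; noncomm_ring
        _ = 1 := by rw [hGs', hHG s hs]; simp [hw3]
  · have h1 : ((1 - s : ℝ) : ℂ) • (d * H s) = 1 - (2 : ℂ) • H s := by
      have := hGH s hs
      rw [hGd, add_mul, smul_mul_assoc, smul_mul_assoc, one_mul] at this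
      rw [← this]
      abel
    simp only [hf]
    rw [smul_add, smul_comm, h1]
    push_cast
    module
  · intro t ht
    have hdiff : f t - f s = ((t - s : ℝ) : ℂ) • ((2 : ℂ) • (d * H t) +
        ((2 * s : ℝ) : ℂ) • (d * (H t * (d * H s)))) := by
      have h1 : H t - H s = ((t - s : ℝ) : ℂ) • (H t * (d * H s)) := by
        calc H t - H s = H t * (G s * H s) - (H t * G t) * H s := by
              rw [hGH s hs, hHG t ht, mul_one, one_mul]
          _ = H t * ((G s - G t) * H s) := by noncomm_ring
          _ = _ := by
              rw [hGd, hGd, show (2 : ℂ) • (1 : E) + ((1 - s : ℝ) : ℂ) • d -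
                ((2 : ℂ) • (1 : E) + ((1 - t : ℝ) : ℂ) • d) = ((t - s : ℝ) : ℂ) • d by
                  push_cast; module, smul_mul_assoc, mul_smul_comm]
      have h3 : d * H s = d * H t - ((t - s : ℝ) : ℂ) • (d * (H t * (d * H s))) := by
        rw [← mul_smul_comm, ← h1]; noncomm_ring
      simp only [hf]
      generalize d * (H t * (d * H s)) = X at h3 ⊢
      rw [h3]
      push_cast
      module
    rw [hdiff, norm_smul, Complex.norm_real, Real.norm_eq_abs]
    refine mul_le_of_le_one_right (abs_nonneg _) ?_
    have e1 : ‖(2 : ℂ) • (d * H t)‖ ≤ 2 * (1 / 3 * (3 / 5)) :=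
      (norm_smul_le _ _).trans (mul_le_mul (by simp)
        (norm_mul_le_of_le hw1 (hHn t ht)) (norm_nonneg _) zero_le_two)
    have e2 : ‖((2 * s : ℝ) : ℂ) • (d * (H t * (d * H s)))‖
        ≤ 2 * (1 / 3 * (3 / 5 * (1 / 3 * (3 / 5)))) := by
      refine (norm_smul_le _ _).trans (mul_le_mul ?_ (norm_mul_le_of_le hw1
        (norm_mul_le_of_le (hHn t ht) (norm_mul_le_of_le hw1 (hHn s hs)))) (norm_nonneg _)
        zero_le_two)
      rw [Complex.norm_real, Real.norm_eq_abs, abs_of_nonneg] <;> linarith [hs.1, hs.2]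
    refine (norm_add_le _ _).trans ((add_le_add e1 e2).trans ?_)
    norm_num

end CStar

section Levels

variable {φ : ∀ n, B n ≃⋆ₐ[ℂ] Matrix (Fin n) (Fin n) A} (𝓕 : LipschitzFiltration A B φ)

namespace LipschitzFiltration

theorem matMem_mono {n : ℕ} {L L' : ℝ≥0} (hL : L ≤ L') {x : Matrix (Fin n) (Fin n) A}
    (hx : MatMem 𝓕.level x L) : MatMem 𝓕.level x L' :=
  fun ξ η hξ hη => 𝓕.mono hL (hx ξ η hξ hη)

theorem matMem_mul_of_norm_le_one {n : ℕ} {L₁ L₂ : ℝ≥0} {a b : B n} (ha : ‖a‖ ≤ 1) (hb : ‖b‖ ≤ 1)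
    (haL : MatMem 𝓕.level (φ n a) L₁) (hbL : MatMem 𝓕.level (φ n b) L₂) :
    MatMem 𝓕.level (φ n (a * b)) (L₁ + L₂) := by
  refine 𝓕.matMem_mono ?_ (𝓕.mat_mul n L₁ L₂ a b haL hbL)
  rw [add_comm L₁]
  exact add_le_add (mul_le_of_le_one_left' (by exact_mod_cast ha))
    (mul_le_of_le_one_left' (by exact_mod_cast hb))

theorem uMem_mul {n : ℕ} {L₁ L₂ : ℝ≥0} {a b : B n} (ha : UMem φ 𝓕 L₁ a) (hb : UMem φ 𝓕 L₂ b) :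
    UMem φ 𝓕 (L₁ + L₂) (a * b) :=
  ⟨𝓕.matMem_mul_of_norm_le_one (norm_le_one_of_mem_unitary ha.2) (norm_le_one_of_mem_unitary hb.2)
    ha.1 hb.1, Submonoid.mul_mem _ ha.2 hb.2⟩

theorem uMem_star {n : ℕ} {L : ℝ≥0} {a : B n} (ha : UMem φ 𝓕 L a) : UMem φ 𝓕 L (star a) :=
  ⟨𝓕.mat_star n L a ha.1, Unitary.star_mem ha.2⟩

theorem matMem_one (n : ℕ) (L : ℝ≥0) : MatMem 𝓕.level (φ n 1) L := by
  have := 𝓕.mat_scalar n L 1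
  rwa [Matrix.map_one _ (by simp) (by simp), ← map_one (φ n)] at this

theorem uMem_one (n : ℕ) (L : ℝ≥0) : UMem φ 𝓕 L (1 : B n) :=
  ⟨𝓕.matMem_one n L, one_mem _⟩

theorem uMem_symmetryRot {n : ℕ} {q : B n} (hq : star q = q) (hq2 : q * q = 1)
    (hqL : MatMem 𝓕.level (φ n q) 0) (θ : ℝ) :
    UMem φ 𝓕 0 (symmetryRot q (Real.cos θ) (Real.sin θ)) := by
  refine ⟨?_, symmetryRot_mem_unitary hq hq2 θ⟩
  have h := 𝓕.mat_add n _ _ _ _ (𝓕.mat_smul n 0 (Real.cos θ : ℂ) 1 (𝓕.matMem_one n 0))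
    (𝓕.mat_smul n 0 (Real.sin θ * Complex.I : ℂ) q hqL)
  rwa [mul_zero, mul_zero, add_zero] at h

/-- Conjugation of one factor of a product of unitaries by a scalar symmetry is implemented by a
path of length `π` of unitaries. -/
theorem lipJoined_conj {n : ℕ} {L₁ L₂ : ℝ≥0} {q a b : B n} (hq : star q = q) (hq2 : q * q = 1)
    (hqL : MatMem 𝓕.level (φ n q) 0) (ha : UMem φ 𝓕 L₁ a) (hb : UMem φ 𝓕 L₂ b) :
    LipJoined {x | UMem φ 𝓕 (L₁ + L₂) x} Real.pi (a * b) (q * a * q * b) := by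
  refine lipJoined_conj_symmetry hq hq2 (norm_le_one_of_mem_unitary ha.2)
    (norm_le_one_of_mem_unitary hb.2) fun θ => ?_
  have hV := 𝓕.uMem_symmetryRot hq hq2 hqL θ
  simpa using 𝓕.uMem_mul (𝓕.uMem_mul (𝓕.uMem_mul hV ha) (𝓕.uMem_star hV)) hb

/-- Unitaries of level `L` at distance at most `1 / 3` are joined by a path of length `1` of
unitaries of level `4 * L`. -/
theorem lipJoined_of_close {n : ℕ} {L : ℝ≥0} {x y : B n} (hx : UMem φ 𝓕 L x) (hy : UMem φ 𝓕 L y)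
    (hxy : ‖x - y‖ ≤ 1 / 3) : LipJoined {b | UMem φ 𝓕 (4 * L) b} 1 x y := by
  have hw := 𝓕.uMem_mul (𝓕.uMem_star hx) hy
  have hxx := Unitary.mem_iff.1 hx.2
  have hw1 : ‖star x * y - 1‖ ≤ 1 / 3 := by
    rw [← hxx.1, ← mul_sub, CStarRing.norm_mem_unitary_mul _ (Unitary.star_mem hx.2),
      norm_sub_rev]
    exact hxy
  obtain ⟨f, H, f0, f1, hf⟩ := exists_cayley_path hw.2 hw1
  set w := star x * y
  refine ⟨fun s => x * f s, by simp [f0], by simp [f1, w, ← mul_assoc, hxx.2], ?_, ?_⟩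
  · intro s hs
    obtain ⟨hfu, hGH, hHG, hHn, hfH, -⟩ := hf s hs
    have key : UMem φ 𝓕 (3 * L) (f s) := by
      refine ⟨?_, hfu⟩
      rcases hs.2.eq_or_lt with rfl | hs1
      · rw [f1]
        refine 𝓕.matMem_mono ?_ hw.1
        rw [← two_mul]
        gcongr
        norm_num
      have hc : ((1 - s : ℝ) : ℂ) ≠ 0 := by
        exact_mod_cast (sub_pos.2 hs1).ne'
      set G := ((1 - s : ℝ) : ℂ) • w + ((1 + s : ℝ) : ℂ) • 1 with hG
      have hG' : ((1 - s : ℝ) : ℂ) • w - algebraMap ℂ (B n) (-((1 + s : ℝ) : ℂ)) = G := by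
        rw [hG, map_neg, sub_neg_eq_add, Algebra.algebraMap_eq_smul_one]
      have hunit : IsUnit (((1 - s : ℝ) : ℂ) • w - algebraMap ℂ (B n) (-((1 + s : ℝ) : ℂ))) := by
        rw [hG']
        exact ⟨⟨G, H s, hGH, hHG⟩, rfl⟩
      have hinv : (↑hunit.unit⁻¹ : B n) = H s := by
        rw [← mul_one (↑hunit.unit⁻¹ : B n), ← hGH, ← mul_assoc, ← hG']
        simp
      have h1 := 𝓕.mat_inv n _ _ _ hunit (𝓕.mat_smul n _ ((1 - s : ℝ) : ℂ) w hw.1)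
      rw [hinv] at h1
      have h2 := 𝓕.mat_add n _ _ _ _ (𝓕.mat_smul n 0 (((1 + s : ℝ) : ℂ) / ((1 - s : ℝ) : ℂ)) 1
        (𝓕.matMem_one n 0)) (𝓕.mat_smul n _ (-((4 * s : ℝ) : ℂ) / ((1 - s : ℝ) : ℂ)) _ h1)
      have h3 : (((1 + s : ℝ) : ℂ) / ((1 - s : ℝ) : ℂ)) • 1 +
          (-((4 * s : ℝ) : ℂ) / ((1 - s : ℝ) : ℂ)) • H s = f s := by
        rw [← inv_smul_smul₀ hc (f s), hfH]
        module
      rw [h3] at h2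
      refine 𝓕.matMem_mono ?_ h2
      rw [← NNReal.coe_le_coe]
      have hs1' : 0 < 1 - s := sub_pos.2 hs1
      have e1 : ‖((1 - s : ℝ) : ℂ)‖ = 1 - s := by
        rw [Complex.norm_real, Real.norm_eq_abs, abs_of_pos hs1']
      have e2 : ‖((4 * s : ℝ) : ℂ)‖ = 4 * s := by
        rw [Complex.norm_real, Real.norm_eq_abs, abs_of_nonneg (by linarith [hs.1])]
      simp only [NNReal.coe_add, NNReal.coe_mul, NNReal.coe_pow, coe_nnnorm, norm_div, norm_neg,
        e1, e2, mul_zero, zero_add, NNReal.coe_ofNat]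
      have h1s : 1 - s ≠ 0 := hs1'.ne'
      have hH2 : ‖H s‖ ^ 2 ≤ (3 / 5) ^ 2 := by gcongr
      calc (4 * s / (1 - s) * (‖H s‖ ^ 2 * ((1 - s) * ((L : ℝ) + L))) : ℝ)
          = s * ‖H s‖ ^ 2 * (8 * (L : ℝ)) := by field_simp; ring
        _ ≤ 1 * (3 / 5) ^ 2 * (8 * (L : ℝ)) := by gcongr
        _ ≤ 3 * (L : ℝ) := by nlinarith [L.coe_nonneg]
    have := 𝓕.uMem_mul hx key
    rwa [show L + 3 * L = 4 * L by ring] at this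
  · intro s hs t ht hst
    dsimp only
    rw [← mul_sub, CStarRing.norm_mem_unitary_mul _ hx.2]
    simpa [abs_of_nonneg (sub_nonneg.2 hst)] using (hf s hs).2.2.2.2.2 t ht

end LipschitzFiltration

section BlockDiag

variable {m N : ℕ} {κ : Type*} [Fintype κ] [DecidableEq κ]

variable (φ) in
/-- Block-diagonal matrices, with entries indexed through `e`. -/
noncomputable def blockDiagHom (e : Fin m × κ ≃ Fin N) : (κ → B m) →⋆ₐ[ℂ] B N where
  toFun x := (φ N).symm (Matrix.reindex e e (Matrix.blockDiagonal fun k => φ m (x k)))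
  map_one' := by
    rw [← map_one (φ N).symm, ← Matrix.submatrix_one_equiv e.symm, ← Matrix.blockDiagonal_one]
    simp [Pi.one_def]
  map_mul' x y := by
    simp only [← map_mul, Matrix.reindex_apply, Matrix.submatrix_mul_equiv,
      ← Matrix.blockDiagonal_mul, Pi.mul_apply]
  map_zero' := by
    rw [← map_zero (φ N).symm]
    congr 1
    ext i j
    simp [Matrix.blockDiagonal_apply]
  map_add' x y := by
    rw [← map_add]
    congr 1
    ext i j
    simp only [Pi.add_apply, map_add, Matrix.reindex_apply, Matrix.submatrix_apply,
      Matrix.blockDiagonal_apply, Matrix.add_apply]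
    split_ifs <;> simp
  commutes' c := by
    rw [Algebra.algebraMap_eq_smul_one, Algebra.algebraMap_eq_smul_one, ← map_one (φ N).symm,
      ← map_smul, ← Matrix.submatrix_one_equiv e.symm, ← Matrix.blockDiagonal_one]
    congr 1
    ext i j
    simp only [Pi.smul_apply, Pi.one_apply, map_smul, map_one, Matrix.reindex_apply,
      Matrix.submatrix_apply, Matrix.blockDiagonal_apply, Matrix.smul_apply]
    split_ifs <;> simp
  map_star' x := by
    rw [← map_star]
    congr 1
    ext i j
    simp only [Pi.star_apply, map_star, Matrix.reindex_apply, Matrix.submatrix_apply,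
      Matrix.blockDiagonal_apply, Matrix.star_apply]
    split_ifs <;> simp_all

theorem apply_blockDiagHom (e : Fin m × κ ≃ Fin N) (x : κ → B m) :
    φ N (blockDiagHom φ e x) =
      Matrix.reindex e e (Matrix.blockDiagonal fun k => φ m (x k)) :=
  (φ N).apply_symm_apply _

variable (φ) in
/-- The scalar matrix permuting the blocks by `σ`. -/
noncomputable def blockPerm (e : Fin m × κ ≃ Fin N) (σ : Equiv.Perm κ) : B N :=
  (φ N).symm ((e.permCongr ((Equiv.refl _).prodCongr σ)).permMatrix A)

omit [Fintype κ] [DecidableEq κ] in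
theorem apply_blockPerm (e : Fin m × κ ≃ Fin N) (σ : Equiv.Perm κ) :
    φ N (blockPerm φ e σ) = (e.permCongr ((Equiv.refl _).prodCongr σ)).permMatrix A :=
  (φ N).apply_symm_apply _

variable {e : Fin m × κ ≃ Fin N} {σ : Equiv.Perm κ}

omit [Fintype κ] [DecidableEq κ] in
theorem inv_permCongr_prodCongr (hσ : Function.Involutive σ) :
    (e.permCongr ((Equiv.refl (Fin m)).prodCongr σ))⁻¹ =
      e.permCongr ((Equiv.refl _).prodCongr σ) := by
  rw [inv_eq_iff_mul_eq_one]
  ext i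
  simp [Prod.map, hσ _]

omit [Fintype κ] [DecidableEq κ] in
theorem star_blockPerm (hσ : Function.Involutive σ) : star (blockPerm φ e σ) = blockPerm φ e σ := by
  apply EquivLike.injective (φ N)
  rw [map_star, apply_blockPerm, Matrix.star_eq_conjTranspose, Matrix.conjTranspose_permMatrix,
    inv_permCongr_prodCongr hσ]

omit [Fintype κ] [DecidableEq κ] in
theorem blockPerm_mul_self (hσ : Function.Involutive σ) :
    blockPerm φ e σ * blockPerm φ e σ = 1 := by
  apply EquivLike.injective (φ N)
  rw [map_mul, apply_blockPerm, ← Matrix.permMatrix_mul, map_one,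
    mul_eq_one_iff_eq_inv.2 (inv_permCongr_prodCongr hσ).symm, Matrix.permMatrix_one]

theorem blockPerm_mul_mul (hσ : Function.Involutive σ) (x : κ → B m) :
    blockPerm φ e σ * blockDiagHom φ e x * blockPerm φ e σ = blockDiagHom φ e (x ∘ σ) := by
  apply EquivLike.injective (φ N)
  rw [map_mul, map_mul, apply_blockPerm, apply_blockDiagHom, apply_blockDiagHom,
    PEquiv.toMatrix_toPEquiv_mul, PEquiv.mul_toMatrix_toPEquiv, ← Equiv.Perm.inv_def,
    inv_permCongr_prodCongr hσ]
  ext i j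
  simp [Matrix.blockDiagonal_apply]

omit [Fintype κ] [DecidableEq κ] in
theorem LipschitzFiltration.matMem_blockPerm :
    MatMem 𝓕.level (φ N (blockPerm φ e σ)) 0 := by
  have := 𝓕.mat_scalar N 0 ((e.permCongr ((Equiv.refl _).prodCongr σ)).permMatrix ℂ)
  rw [apply_blockPerm]
  convert this
  ext i j
  simp [Equiv.Perm.permMatrix, PEquiv.toMatrix_apply]

theorem norm_blockDiagHom_le (x : κ → B m) {r : ℝ} (hr : 0 ≤ r) (hx : ∀ k, ‖x k‖ ≤ r) :
    ‖blockDiagHom φ e x‖ ≤ r :=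
  (NonUnitalStarAlgHom.norm_apply_le _ _).trans ((pi_norm_le_iff_of_nonneg hr).2 hx)

namespace LipschitzFiltration

theorem sum_mem_level_s10 {ι : Type*} (s : Finset ι) (a : ι → A) (l : ι → ℝ≥0)
    (ha : ∀ k, a k ∈ 𝓕.level (l k)) : ∑ k ∈ s, a k ∈ 𝓕.level (∑ k ∈ s, l k) := by
  classical
  induction s using Finset.induction_on with
  | empty => simpa using 𝓕.scalar_mem 0 0
  | insert k s hk ih =>
    rw [Finset.sum_insert hk, Finset.sum_insert hk]
    exact 𝓕.add_mem _ _ _ _ (ha k) ih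

/-- Homogeneous form of the membership in a matrix level. -/
theorem sum_smul_mem_level {n : ℕ} {L : ℝ≥0} {x : Matrix (Fin n) (Fin n) A}
    (hx : MatMem 𝓕.level x L) (ξ η : Fin n → ℂ) :
    (∑ i, ∑ j, (ξ i * η j) • x i j) ∈
      𝓕.level (NNReal.sqrt (∑ i, ‖ξ i‖₊ ^ 2) * NNReal.sqrt (∑ i, ‖η i‖₊ ^ 2) * L) := by
  have h0 : ∀ ζ : Fin n → ℂ, NNReal.sqrt (∑ i, ‖ζ i‖₊ ^ 2) = 0 → ∀ i, ζ i = 0 := by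
    intro ζ h i
    have := Finset.sum_eq_zero_iff.1 (NNReal.sqrt_eq_zero.1 h) i (Finset.mem_univ i)
    simpa using this
  have h1 : ∀ ζ : Fin n → ℂ, NNReal.sqrt (∑ i, ‖ζ i‖₊ ^ 2) ≠ 0 →
      ∑ i, ‖((NNReal.sqrt (∑ i, ‖ζ i‖₊ ^ 2) : ℝ) : ℂ)⁻¹ * ζ i‖ ^ 2 ≤ 1 := by
    intro ζ h
    have h2 : ((NNReal.sqrt (∑ i, ‖ζ i‖₊ ^ 2) : ℝ≥0) : ℝ) ^ 2 = ∑ i, ‖ζ i‖ ^ 2 := by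
      rw [← NNReal.coe_pow, NNReal.sq_sqrt]
      push_cast
      rfl
    have h3 : ((NNReal.sqrt (∑ i, ‖ζ i‖₊ ^ 2) : ℝ≥0) : ℝ) ≠ 0 := by exact_mod_cast h
    simp only [norm_mul, norm_inv, Complex.norm_real, Real.norm_eq_abs, mul_pow, inv_pow, sq_abs]
    rw [← Finset.mul_sum, ← h2, inv_mul_cancel₀ (pow_ne_zero 2 h3)]
  by_cases hξ : NNReal.sqrt (∑ i, ‖ξ i‖₊ ^ 2) = 0
  · simpa [h0 ξ hξ] using 𝓕.scalar_mem _ 0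
  by_cases hη : NNReal.sqrt (∑ i, ‖η i‖₊ ^ 2) = 0
  · simpa [h0 η hη] using 𝓕.scalar_mem _ 0
  have h := 𝓕.smul_mem L (((NNReal.sqrt (∑ i, ‖ξ i‖₊ ^ 2) : ℝ) : ℂ) *
    ((NNReal.sqrt (∑ i, ‖η i‖₊ ^ 2) : ℝ) : ℂ)) _ (hx _ _ (h1 ξ hξ) (h1 η hη))
  have hξ' : ((NNReal.sqrt (∑ i, ‖ξ i‖₊ ^ 2) : ℝ) : ℂ) ≠ 0 := by exact_mod_cast hξ
  have hη' : ((NNReal.sqrt (∑ i, ‖η i‖₊ ^ 2) : ℝ) : ℂ) ≠ 0 := by exact_mod_cast hη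
  generalize NNReal.sqrt (∑ i, ‖ξ i‖₊ ^ 2) = α at *
  generalize NNReal.sqrt (∑ i, ‖η i‖₊ ^ 2) = β at *
  convert h using 2
  · simp
  · simp only [Finset.smul_sum, smul_smul]
    refine Finset.sum_congr rfl fun i _ => Finset.sum_congr rfl fun j _ => ?_
    congr 1
    field_simp

theorem matMem_blockDiagHom {L : ℝ≥0} {x : κ → B m} (hx : ∀ k, MatMem 𝓕.level (φ m (x k)) L) :
    MatMem 𝓕.level (φ N (blockDiagHom φ e x)) L := by
  intro ξ η hξ hη
  have hsum : ∀ ζ : Fin N → ℂ, ∑ i, ‖ζ i‖ ^ 2 = ∑ k, ∑ i, ‖ζ (e (i, k))‖ ^ 2 := by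
    intro ζ
    rw [← e.sum_comp, Fintype.sum_prod_type_right]
  rw [hsum] at hξ hη
  rw [apply_blockDiagHom, ← e.sum_comp, Fintype.sum_prod_type_right]
  have hentry : ∀ (i : Fin m) (k : κ), ∑ q, (ξ (e (i, k)) * η q) •
      Matrix.reindex e e (Matrix.blockDiagonal fun k => φ m (x k)) (e (i, k)) q =
      ∑ j, (ξ (e (i, k)) * η (e (j, k))) • φ m (x k) i j := by
    intro i k
    rw [← e.sum_comp, Fintype.sum_prod_type]
    simp [Matrix.blockDiagonal_apply]
  simp only [hentry]
  refine 𝓕.mono ?_ (𝓕.sum_mem_level_s10 _ _ _ fun k => 𝓕.sum_smul_mem_level (hx k)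
    (fun i => ξ (e (i, k))) (fun j => η (e (j, k))))
  rw [← Finset.sum_mul]
  refine mul_le_of_le_one_left' ?_
  rw [← NNReal.coe_le_coe]
  push_cast
  calc ∑ k, √(∑ i, ‖ξ (e (i, k))‖ ^ 2) * √(∑ i, ‖η (e (i, k))‖ ^ 2)
      ≤ ∑ k, ((∑ i, ‖ξ (e (i, k))‖ ^ 2) + ∑ i, ‖η (e (i, k))‖ ^ 2) / 2 := by
        refine Finset.sum_le_sum fun k _ => ?_
        have h1 := Real.sq_sqrt (Finset.sum_nonneg fun i (_ : i ∈ Finset.univ) =>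
          sq_nonneg ‖ξ (e (i, k))‖)
        have h2 := Real.sq_sqrt (Finset.sum_nonneg fun i (_ : i ∈ Finset.univ) =>
          sq_nonneg ‖η (e (i, k))‖)
        have h3 := sq_nonneg (√(∑ i, ‖ξ (e (i, k))‖ ^ 2) - √(∑ i, ‖η (e (i, k))‖ ^ 2))
        nlinarith
    _ ≤ 1 := by
        rw [← Finset.sum_div, Finset.sum_add_distrib]
        linarith

theorem uMem_blockDiagHom {L : ℝ≥0} {x : κ → B m} (hx : ∀ k, UMem φ 𝓕 L (x k)) :
    UMem φ 𝓕 L (blockDiagHom φ e x) := by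
  refine ⟨𝓕.matMem_blockDiagHom fun k => (hx k).1, ?_⟩
  rw [Unitary.mem_iff, ← map_star, ← map_mul, ← map_mul, ← map_one (blockDiagHom φ e)]
  constructor <;> congr 1 <;> funext k
  exacts [(Unitary.mem_iff.1 (hx k).2).1, (Unitary.mem_iff.1 (hx k).2).2]

/-- Permuting by an involution the blocks of one factor of a product of block-diagonal unitaries
is implemented by a path of length `π`. -/
theorem lipJoined_blockDiagHom {L : ℝ≥0} (hσ : Function.Involutive σ) {a b : κ → B m}
    (ha : ∀ k, UMem φ 𝓕 L (a k)) (hb : ∀ k, UMem φ 𝓕 L (b k)) :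
    LipJoined {x | UMem φ 𝓕 (4 * L) x} Real.pi (blockDiagHom φ e (a * b))
      (blockDiagHom φ e ((a ∘ σ) * b)) := by
  have h := 𝓕.lipJoined_conj (star_blockPerm hσ) (blockPerm_mul_self hσ)
    (𝓕.matMem_blockPerm (e := e)) (𝓕.uMem_blockDiagHom (e := e) ha)
    (𝓕.uMem_blockDiagHom (e := e) hb)
  rw [blockPerm_mul_mul hσ, ← map_mul, ← map_mul] at h
  obtain ⟨f, f0, f1, fS, fL⟩ := h
  refine ⟨f, f0, f1, fun t ht => ⟨𝓕.matMem_mono ?_ (fS t ht).1, (fS t ht).2⟩, fL⟩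
  rw [← two_mul]
  gcongr
  norm_num

end LipschitzFiltration

variable (φ) in
/-- The index set of a block-diagonal matrix can be enumerated so that placing `u ⊕ 1` in the
block `k₀` of an identity matrix gives again `u ⊕ 1`. -/
theorem exists_blockDiagHom_mulSingle_eq_oplus (n j : ℕ) (k₀ : κ) :
    ∃ (J : ℕ) (e : Fin (n + j) × κ ≃ Fin (n + J)), ∀ u : B n,
      blockDiagHom φ e (Pi.mulSingle k₀ (oplus φ u (1 : B j))) = oplus φ u (1 : B J) := by
  classical
  let f : Fin n → Fin (n + j) × κ := fun i => (Fin.castAdd j i, k₀)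
  have hf : Function.Injective f := fun i i' h =>
    Fin.castAdd_injective n j (Prod.ext_iff.1 h).1
  let R := ((Set.range f)ᶜ : Set (Fin (n + j) × κ))
  let e₀ : Fin n ⊕ Fin (Fintype.card R) ≃ Fin (n + j) × κ :=
    ((Equiv.ofInjective f hf).sumCongr (Fintype.equivFin R).symm).trans
      (Equiv.Set.sumCompl (Set.range f))
  have he₀l : ∀ i, e₀ (Sum.inl i) = f i := fun i => rfl
  have he₀r : ∀ r, e₀ (Sum.inr r) ∉ Set.range f := fun r => ((Fintype.equivFin R).symm r).2
  refine ⟨Fintype.card R, e₀.symm.trans finSumFinEquiv, fun u => ?_⟩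
  have hM : ∀ p q, p ∉ Set.range f ∨ q ∉ Set.range f → Matrix.blockDiagonal
      (fun k => φ (n + j) ((Pi.mulSingle k₀ (oplus φ u (1 : B j)) : κ → B (n + j)) k)) p q =
        if p = q then 1 else 0 := by
    rintro ⟨p, k⟩ ⟨q, k'⟩ h
    rw [Matrix.blockDiagonal_apply]
    by_cases hk : k = k'
    swap
    · simp [hk]
    subst hk
    by_cases hk : k = k₀
    swap
    · simp [hk, Matrix.one_apply]
    subst hk
    simp only [Pi.mulSingle_eq_same, oplus, StarAlgEquiv.apply_symm_apply, map_one]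
    induction p using Fin.addCases <;> induction q using Fin.addCases <;>
      simp_all [f, Matrix.one_apply, Fin.ext_iff] <;> omega
  have hR : φ (n + Fintype.card R) (oplus φ u 1) = Matrix.reindex finSumFinEquiv finSumFinEquiv
      (Matrix.fromBlocks (φ n u) 0 0 (φ (Fintype.card R) 1)) := (φ _).apply_symm_apply _
  apply EquivLike.injective (φ _)
  rw [apply_blockDiagHom, hR, ← Equiv.symm_apply_eq]
  ext p q
  simp only [Matrix.reindex_symm, Matrix.reindex_apply, Matrix.submatrix_apply,
    Equiv.symm_trans_apply, Equiv.symm_symm, Equiv.symm_apply_apply]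
  rcases p with i | r <;> rcases q with i' | r'
  · simp [he₀l, f, oplus, Matrix.blockDiagonal_apply]
  · rw [hM _ _ (Or.inr (he₀r r'))]
    simp
  · rw [hM _ _ (Or.inl (he₀r r))]
    simp
  · rw [hM _ _ (Or.inl (he₀r r))]
    simp [Matrix.one_apply]

end BlockDiag

/-- The end points of a chain of unitaries of level `L` with steps at most `1 / 3` are joined
stably by a path of length `3π + 1` of unitaries of level `4 * L`. -/
theorem LipschitzFiltration.lipJoined_of_chain {m N k : ℕ} {L : ℝ≥0}
    (e : Fin m × (Fin (k + 1) ⊕ Fin k) ≃ Fin N) (u : Fin (k + 1) → B m)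
    (hu : ∀ i, UMem φ 𝓕 L (u i)) (hclose : ∀ i : Fin k, ‖u i.succ - u i.castSucc‖ ≤ 1 / 3) :
    LipJoined {x | UMem φ 𝓕 (4 * L) x} (Real.pi + (1 + (Real.pi + Real.pi)))
      (blockDiagHom φ e (Pi.mulSingle (Sum.inl 0) (u 0)))
      (blockDiagHom φ e (Pi.mulSingle (Sum.inl 0) (u (Fin.last k)))) := by
  have hsingle : ∀ {ι : Type} [DecidableEq ι] (i₀ : ι) {x : B m}, UMem φ 𝓕 L x →
      ∀ i, UMem φ 𝓕 L ((Pi.mulSingle i₀ x : ι → B m) i) := by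
    intro ι _ i₀ x hx i
    by_cases h : i = i₀
    · subst h; simpa using hx
    · simpa [h] using 𝓕.uMem_one m L
  let τ₁ : Fin (k + 1) ⊕ Fin k → Fin (k + 1) ⊕ Fin k :=
    Sum.elim (Fin.cases (Sum.inl 0) Sum.inr) (fun i => Sum.inl i.succ)
  have hτ₁ : Function.Involutive τ₁ := by
    rintro (i | i)
    · induction i using Fin.cases <;> simp [τ₁]
    · simp [τ₁]
  let τ₂ : Fin (k + 1) ⊕ Fin k → Fin (k + 1) ⊕ Fin k :=
    Sum.elim (Fin.lastCases (Sum.inl (Fin.last k)) Sum.inr) (fun i => Sum.inl i.castSucc)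
  have hτ₂ : Function.Involutive τ₂ := by
    rintro (i | i)
    · induction i using Fin.lastCases <;> simp [τ₂]
    · simp [τ₂]
  let a₁ : Fin (k + 1) ⊕ Fin k → B m :=
    Sum.elim 1 fun i => u i.succ
  let b₁ : Fin (k + 1) ⊕ Fin k → B m :=
    Sum.elim (Pi.mulSingle 0 (u 0)) fun i => star (u i.succ)
  let a₂ : Fin (k + 1) ⊕ Fin k → B m :=
    Sum.elim (Fin.lastCases 1 fun i => u i.castSucc) 1
  let b₂ : Fin (k + 1) ⊕ Fin k → B m :=
    Sum.elim (Pi.mulSingle (Fin.last k) (u (Fin.last k))) fun i => star (u i.castSucc)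
  have step₁ := 𝓕.lipJoined_blockDiagHom (e := e) (σ := hτ₁.toPerm) (L := L) hτ₁
    (a := a₁) (b := b₁)
    (Sum.rec (fun i => 𝓕.uMem_one m L) fun i => hu _)
    (Sum.rec (hsingle 0 (hu 0)) fun i => 𝓕.uMem_star (hu _))
  have step₂ := 𝓕.lipJoined_of_close (L := L)
    (x := blockDiagHom φ e (Sum.elim u fun i => star (u i.succ)))
    (y := blockDiagHom φ e (Sum.elim u fun i => star (u i.castSucc)))
    (𝓕.uMem_blockDiagHom (Sum.rec hu fun i => 𝓕.uMem_star (hu _)))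
    (𝓕.uMem_blockDiagHom (Sum.rec hu fun i => 𝓕.uMem_star (hu _)))
    (by
      rw [← map_sub]
      refine norm_blockDiagHom_le _ (by norm_num) (Sum.rec (fun i => ?_) fun i => ?_)
      · simp
      · simpa [← star_sub] using hclose i)
  have step₃ := 𝓕.lipJoined_blockDiagHom (e := e) (σ := hτ₂.toPerm) (L := L) hτ₂
    (a := a₂) (b := b₂)
    (Sum.rec (Fin.lastCases (by simpa [a₂] using 𝓕.uMem_one m L) fun i => by simpa [a₂] using hu _)
      fun i => 𝓕.uMem_one m L)
    (Sum.rec (hsingle _ (hu _)) fun i => 𝓕.uMem_star (hu _))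
  have step₄ := 𝓕.lipJoined_blockDiagHom (e := e)
    (σ := Equiv.swap (Sum.inl 0) (Sum.inl (Fin.last k))) (L := L)
    (fun i => Equiv.swap_apply_self _ _ i)
    (a := Pi.mulSingle (Sum.inl (Fin.last k)) (u (Fin.last k))) (b := 1)
    (hsingle _ (hu _)) (fun i => 𝓕.uMem_one m L)
  have hpi := Real.pi_pos.le
  have h₁ : a₁ * b₁ = Pi.mulSingle (Sum.inl 0) (u 0) := by
    funext i
    rcases i with i | i
    · simp [a₁, b₁, Pi.mulSingle_apply]
    · simp [a₁, b₁, (Unitary.mem_iff.1 (hu _).2).2]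
  have h₂ : a₁ ∘ hτ₁.toPerm * b₁ = Sum.elim u fun i => star (u i.succ) := by
    funext i
    rcases i with i | i
    · induction i using Fin.cases <;> simp [a₁, b₁, τ₁]
    · simp [a₁, b₁, τ₁]
  have h₃ : a₂ * b₂ = Sum.elim u fun i => star (u i.castSucc) := by
    funext i
    rcases i with i | i
    · induction i using Fin.lastCases <;> simp [a₂, b₂]
    · simp [a₂, b₂]
  have h₄ : a₂ ∘ hτ₂.toPerm * b₂ = Pi.mulSingle (Sum.inl (Fin.last k)) (u (Fin.last k)) := by
    funext i
    rcases i with i | i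
    · induction i using Fin.lastCases <;> simp [a₂, b₂, τ₂]
    · simp [a₂, b₂, τ₂, (Unitary.mem_iff.1 (hu _).2).2]
  have h₅ : (Pi.mulSingle (Sum.inl (Fin.last k)) (u (Fin.last k)) :
      Fin (k + 1) ⊕ Fin k → B m) ∘ Equiv.swap (Sum.inl 0) (Sum.inl (Fin.last k)) =
      Pi.mulSingle (Sum.inl 0) (u (Fin.last k)) := by
    funext i
    simp only [Function.comp_apply, Pi.mulSingle_apply, Equiv.swap_apply_eq_iff,
      Equiv.swap_apply_right]
  rw [h₁, h₂] at step₁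
  rw [h₃, h₄] at step₃
  rw [mul_one, mul_one, h₅] at step₄
  exact step₁.trans hpi (by positivity) (step₂.trans zero_le_one (by positivity)
    (step₃.trans hpi hpi step₄))

end Levels
/-- if `u, v ∈ U^L_n(A)` are homotopic in `U^L(A)` (i.e. `u ⊕ I_j` and
`v ⊕ I_j` are joined by a norm-continuous path of unitaries at level `L` for some `j`),
then for some `N = n + j ≥ n` the unitaries `u ⊕ I_{N-n}` and `v ⊕ I_{N-n}` are joined by
an 11-Lipschitz homotopy of unitaries at level `4L`. -/
theorem stmt10 (φ : ∀ n, B n ≃⋆ₐ[ℂ] Matrix (Fin n) (Fin n) A)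
    (𝓕 : LipschitzFiltration A B φ) {n : ℕ} (L : ℝ≥0) (u v : B n)
    (hu : UMem φ 𝓕 L u) (hv : UMem φ 𝓕 L v)
    (hhom : ∃ (j : ℕ) (g : ℝ → B (n + j)), ContinuousOn g (Set.Icc (0 : ℝ) 1) ∧
      g 0 = oplus φ u (1 : B j) ∧ g 1 = oplus φ v (1 : B j) ∧
      ∀ t ∈ Set.Icc (0 : ℝ) 1, UMem φ 𝓕 L (g t)) :
    ∃ (j : ℕ) (h : ℝ → B (n + j)),
      h 0 = oplus φ u (1 : B j) ∧
      h 1 = oplus φ v (1 : B j) ∧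
      (∀ t ∈ Set.Icc (0 : ℝ) 1, UMem φ 𝓕 (4 * L) (h t)) ∧
      (∀ t ∈ Set.Icc (0 : ℝ) 1, ∀ s ∈ Set.Icc (0 : ℝ) 1, ‖h t - h s‖ ≤ 11 * |t - s|) := by
  obtain ⟨j, g, hgc, g0, g1, hgU⟩ := hhom
  obtain ⟨δ, hδ, hgδ⟩ := Metric.uniformContinuousOn_iff.1
    (isCompact_Icc.uniformContinuousOn_of_continuous hgc) (1 / 3) (by norm_num)
  obtain ⟨k, hk⟩ := exists_nat_one_div_lt hδ
  have hk0 : (0 : ℝ) < (k : ℝ) + 1 := by positivity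
  have hmem : ∀ i : Fin (k + 1 + 1), (i : ℝ) / ((k : ℝ) + 1) ∈ Set.Icc (0 : ℝ) 1 := fun i =>
    ⟨by positivity, (div_le_one hk0).2 (by exact_mod_cast Nat.lt_succ_iff.1 i.2)⟩
  obtain ⟨J, e, he⟩ := exists_blockDiagHom_mulSingle_eq_oplus φ n j
    (Sum.inl 0 : Fin (k + 1 + 1) ⊕ Fin (k + 1))
  have hchain := 𝓕.lipJoined_of_chain e (fun i => g ((i : ℝ) / ((k : ℝ) + 1)))
    (fun i => hgU _ (hmem i)) fun i => by
      rw [← dist_eq_norm]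
      refine (hgδ _ (hmem _) _ (hmem _) ?_).le
      rw [Real.dist_eq, ← sub_div]
      simpa [abs_of_pos hk0] using hk
  have h0 : g (((0 : Fin (k + 1 + 1)) : ℝ) / ((k : ℝ) + 1)) = oplus φ u 1 := by simp [g0]
  have h1 : g (((Fin.last (k + 1) : Fin (k + 1 + 1)) : ℝ) / ((k : ℝ) + 1)) = oplus φ v 1 := by
    simp [div_self hk0.ne', g1]
  rw [h0, h1, he, he] at hchain
  have hpi := Real.pi_pos
  have hpi' := Real.pi_lt_d2
  refine ⟨J, hchain.exists_lipschitz (by positivity) (by linarith) ?_⟩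
  obtain ⟨f, -, f1, fS, -⟩ := hchain
  rw [← f1]
  exact fS _ ⟨by positivity, le_rfl⟩
end
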